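/- Assume Hypothesis (A) or Hypothesis (B), and assume (as can be arranged by a linear change of coordinates) that every common zero a_1,…,a_s of ∂f^(δ)/∂x_1,…,∂f^(δ)/∂x_n in P^{n−1} lies in the chart x_n ≠ 0. Set h(y_1,…,y_{n−1}) = f^(δ)(y_1,…,y_{n−1},1), and for each i let μ_i = dim_K of the localization of K[y_1,…,y_{n−1}]/(∂h/∂y_1,…,∂h/∂y_{n−1}) at the maximal ideal corresponding to a_i (the Milnor number of a_i). Then the sum M_f of the Milnor numbers of the critical points of the map f : A^n → A^1 — equivalently, dim_K K[x_1,…,x_n]/(∂f/∂x_1,…,∂f/∂x_n) — satisfies M_f = (δ−1)^n − (δ−δ')·Σ_{i=1}^s μ_i. -/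

import Mathlib

open MvPolynomial

noncomputable section

/-- A polynomial differential `m`-form over `K[x_1,…,x_n]`, recorded by its coefficients:
to each subset `T ⊆ {1,…,n}` of cardinality `m` (the index set `i_1 < ⋯ < i_m` of
`dx_{i_1} ∧ ⋯ ∧ dx_{i_m}`) we assign a polynomial coefficient. -/
abbrev MForm (K : Type*) [CommSemiring K] (n m : ℕ) : Type _ :=
  ∀ T : Finset (Fin n), T.card = m → MvPolynomial (Fin n) K

/-- The wedge product `dg ∧ ω` of the exterior derivative of `g` with an `m`-form `ω`:
its coefficient on `T = {i_0 < ⋯ < i_m}` is `∑ k, (-1)^k (∂g/∂x_{i_k}) ω(T \ {i_k})`. -/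
def wedgeD {K : Type*} [CommRing K] {n m : ℕ} (g : MvPolynomial (Fin n) K)
    (ω : MForm K n m) : MForm K n (m + 1) := fun T hT =>
  ∑ j ∈ T.attach,
    (-1 : MvPolynomial (Fin n) K) ^ (T.filter (fun i => i < j.1)).card *
      pderiv j.1 g * ω (T.erase j.1) (by rw [Finset.card_erase_of_mem j.2]; omega)

/-- `g` is homogeneous of (possibly negative) degree `d : ℤ`; by convention the only
homogeneous polynomial of negative degree is `0`. -/
def HomogZ {K : Type*} [CommSemiring K] {σ : Type*} (g : MvPolynomial σ K) (d : ℤ) : Prop :=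
  g = 0 ∨ ∃ d' : ℕ, (d' : ℤ) = d ∧ g.IsHomogeneous d'

/-- A list of ring elements is a regular sequence when each entry is a nonzerodivisor
modulo the ideal generated by the preceding entries. -/
def IsRegSeq {R : Type*} [CommRing R] (rs : List R) : Prop :=
  ∀ (i : ℕ) (hi : i < rs.length) (x : R),
    rs[i] * x ∈ Ideal.span {y | ∃ (j : ℕ) (hj : j < i), y = rs[j]'(hj.trans hi)} →
    x ∈ Ideal.span {y | ∃ (j : ℕ) (hj : j < i), y = rs[j]'(hj.trans hi)}

/-- The origin is an isolated critical point of (the polynomial map defined by) `h`: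
it is a common zero of all partial derivatives `∂h/∂x_i`, and there is a Zariski-open
neighborhood `U` of the origin (wlog a basic open set `u ≠ 0` with `u(0) ≠ 0`) on which
the origin is the only common zero of the `∂h/∂x_i`. -/
def IsIsolatedCriticalAtZero {K : Type*} [CommSemiring K] {σ : Type*}
    (h : MvPolynomial σ K) : Prop :=
  (∀ i, eval (0 : σ → K) (pderiv i h) = 0) ∧
  ∃ u : MvPolynomial σ K, eval (0 : σ → K) u ≠ 0 ∧
    ∀ y : σ → K, eval y u ≠ 0 → (∀ i, eval y (pderiv i h) = 0) → y = 0

/-- The dehomogenization of `F` in the affine chart `x_j = 1` of `ℙ^{n-1}`, centered at the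
point `a` (which should satisfy `a j = 1`): a polynomial in the `n-1` variables `i ≠ j`. -/
def chartPoly {K : Type*} [CommRing K] {n : ℕ} (F : MvPolynomial (Fin n) K) (j : Fin n)
    (a : Fin n → K) : MvPolynomial {i : Fin n // i ≠ j} K :=
  aeval (fun i : Fin n => if h : i = j then 1 else X ⟨i, h⟩ + C (a i)) F

/-- `g` is weighted homogeneous of total degree `d`: there are positive integer weights
`α_i` with gcd `1` such that every monomial of `g` has weighted degree `d`
(equivalently, `g(λ^{α_1}x_1,…) = λ^d g(x)`). -/
def IsWeightedHomogTD {K : Type*} [CommSemiring K] {σ : Type*} [Fintype σ]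
    (g : MvPolynomial σ K) (d : ℕ) : Prop :=
  ∃ α : σ → ℕ, (∀ i, 0 < α i) ∧ Finset.univ.gcd α = 1 ∧ IsWeightedHomogeneous α g d

/-- The hypersurface `h = 0` has a weighted homogeneous singularity at the origin, of total
degree `d`: the complete local ring `K[[x]]/(h)` is isomorphic as a `K`-algebra to
`K[[x]]/(g)` for some weighted homogeneous `g` of total degree `d`. -/
def WeightedHomogSing {K : Type*} [Field K] {σ : Type*} [Fintype σ]
    (h : MvPolynomial σ K) (d : ℕ) : Prop :=
  ∃ g : MvPolynomial σ K, IsWeightedHomogTD g d ∧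
    Nonempty ((MvPowerSeries σ K ⧸ Ideal.span {(h : MvPowerSeries σ K)}) ≃ₐ[K]
      MvPowerSeries σ K ⧸ Ideal.span {(g : MvPowerSeries σ K)})

/-- The common zero locus, in the projective space `ℙ^{n-1}`, of a set `S` of
(homogeneous) polynomials. -/
def projZeros {K : Type*} [Field K] {n : ℕ} (S : Set (MvPolynomial (Fin n) K)) :
    Set (Projectivization K (Fin n → K)) :=
  {x | ∃ (v : Fin n → K) (hv : v ≠ 0), Projectivization.mk K v hv = x ∧ ∀ g ∈ S, eval v g = 0}

/-- A homogeneous polynomial `G` in `m` variables defines a smooth hypersurface in `ℙ^{m-1}`: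
`G` and its partial derivatives have no common zero in `ℙ^{m-1}`. -/
def SmoothProj {K : Type*} [Field K] {σ : Type*} (G : MvPolynomial σ K) : Prop :=
  ∀ y : σ → K, y ≠ 0 → ¬ (eval y G = 0 ∧ ∀ i, eval y (pderiv i G) = 0)

/-- `F(x_1,…,x_{n-1},0)`, as a polynomial in the first `n-1` variables. -/
def truncAtLast {K : Type*} [CommRing K] {n : ℕ} (F : MvPolynomial (Fin n) K) :
    MvPolynomial (Fin (n - 1)) K :=
  aeval (fun i : Fin n => if h : (i : ℕ) < n - 1 then X (⟨i, h⟩ : Fin (n - 1)) else 0) F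

/-- `F(y_1,…,y_{n-1},1)`, as a polynomial in the first `n-1` variables. -/
def dehomAtLast {K : Type*} [CommRing K] {n : ℕ} (F : MvPolynomial (Fin n) K) :
    MvPolynomial (Fin (n - 1)) K :=
  aeval (fun i : Fin n => if h : (i : ℕ) < n - 1 then X (⟨i, h⟩ : Fin (n - 1)) else 1) F

/-- The point `(b, 1) ∈ K^n` lying over `b ∈ K^{n-1}` (affine chart `x_n = 1`). -/
def liftPt {K : Type*} [CommRing K] {n : ℕ} (b : Fin (n - 1) → K) : Fin n → K :=
  fun i => if h : (i : ℕ) < n - 1 then b ⟨i, h⟩ else 1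

/-- Context of the paper: `f` has degree `δ ≥ 2`, `1 ≤ δ' ≤ δ - 1`, and
`f = f^(δ) + f^(δ') + (terms of degree < δ')`, with `f^(δ')` the (nonzero) homogeneous
component of second-highest degree. -/
def Setup {K : Type*} [Field K] {n : ℕ} (δ δ' : ℕ) (f : MvPolynomial (Fin n) K) : Prop :=
  f.totalDegree = δ ∧ 2 ≤ δ ∧ 1 ≤ δ' ∧ δ' < δ ∧
  (∀ j, δ' < j → j < δ → homogeneousComponent j f = 0) ∧
  homogeneousComponent δ' f ≠ 0

/-- Hypothesis (A): `p ∤ δ`, `p ∤ δ'`; every singular point of the hypersurface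
`f^(δ) = 0` in `ℙ^{n-1}` (taken with a representative normalized by `a j = 1`) is an
isolated singularity, weighted homogeneous of some total degree `d` with `p ∤ d`,
and does not lie on the hypersurface `f^(δ') = 0`. -/
def HypA {K : Type*} [Field K] {n : ℕ} (p δ δ' : ℕ) (f : MvPolynomial (Fin n) K) : Prop :=
  ¬ (p ∣ δ) ∧ ¬ (p ∣ δ') ∧
  ∀ (a : Fin n → K) (j : Fin n), a j = 1 →
    eval a (homogeneousComponent δ f) = 0 →
    (∀ i, eval a (pderiv i (homogeneousComponent δ f)) = 0) →
    IsIsolatedCriticalAtZero (chartPoly (homogeneousComponent δ f) j a) ∧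
    (∃ d : ℕ, ¬ (p ∣ d) ∧ WeightedHomogSing (chartPoly (homogeneousComponent δ f) j a) d) ∧
    eval a (homogeneousComponent δ' f) ≠ 0

/-- Hypothesis (B): `p ∣ δ`, `p ∤ δ'`, the common zero locus of the `∂f^(δ)/∂x_i` in
`ℙ^{n-1}` is finite and nonempty, and none of its points lies on the hypersurface
`f^(δ') = 0`. -/
def HypB {K : Type*} [Field K] {n : ℕ} (p δ δ' : ℕ) (f : MvPolynomial (Fin n) K) : Prop :=
  (p ∣ δ) ∧ ¬ (p ∣ δ') ∧
  (projZeros {g | ∃ i, g = pderiv i (homogeneousComponent δ f)}).Finite ∧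
  (projZeros {g | ∃ i, g = pderiv i (homogeneousComponent δ f)}).Nonempty ∧
  ∀ a : Fin n → K, a ≠ 0 → (∀ i, eval a (pderiv i (homogeneousComponent δ f)) = 0) →
    eval a (homogeneousComponent δ' f) ≠ 0

/-- The localization of the polynomial ring at the maximal ideal of the point `b`. -/
instance evalKerPrime (K : Type*) [Field K] (σ : Type*) (b : σ → K) :
    (RingHom.ker (eval b : MvPolynomial σ K →+* K)).IsPrime := RingHom.ker_isPrime _

/-- The local ring of affine space at the point `b`, i.e. the localization of the
polynomial ring at the maximal ideal of polynomials vanishing at `b`. -/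
abbrev LocAt (K : Type*) [Field K] {σ : Type*} (b : σ → K) :=
  Localization.AtPrime (RingHom.ker (eval b : MvPolynomial σ K →+* K))

/-- The Milnor number of `h` at the point `b`: the `K`-dimension of the quotient of the
local ring at `b` by the ideal generated by the partial derivatives of `h`. -/
def milnorAt {K : Type*} [Field K] {σ : Type*} (b : σ → K) (h : MvPolynomial σ K) : ℕ :=
  Module.finrank K
    ((LocAt K b) ⧸ Ideal.span (Set.range fun i =>
      algebraMap (MvPolynomial σ K) (LocAt K b) (pderiv i h)))

open MvPolynomial
noncomputable section
namespace Bez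

section Basic
variable {σ : Type*} {K : Type*} [Field K]

lemma hc_mul {F : MvPolynomial σ K} {d : ℕ} (hF : F.IsHomogeneous d) (p : MvPolynomial σ K)
    (k : ℕ) : homogeneousComponent (k + d) (p * F) = homogeneousComponent k p * F := by
  letI := MvPolynomial.gradedAlgebra (σ := σ) (R := K)
  have := DirectSum.coe_decompose_mul_add_of_right_mem (homogeneousSubmodule σ K) (i := k)
    (a := p) (b := F) ((mem_homogeneousSubmodule d F).2 hF)
  rw [← decomposition.decompose'_apply, ← decomposition.decompose'_apply]
  exact this

lemma hc_mul_lt {F : MvPolynomial σ K} {d : ℕ} (hF : F.IsHomogeneous d) (p : MvPolynomial σ K)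
    {k : ℕ} (hk : k < d) : homogeneousComponent k (p * F) = 0 := by
  letI := MvPolynomial.gradedAlgebra (σ := σ) (R := K)
  have := DirectSum.coe_decompose_mul_of_right_mem_of_not_le (homogeneousSubmodule σ K) (n := k)
    (a := p) (b := F) ((mem_homogeneousSubmodule d F).2 hF) (by omega)
  rw [← decomposition.decompose'_apply]
  exact this

lemma hc_hc (p : MvPolynomial σ K) (j k : ℕ) :
    homogeneousComponent j (homogeneousComponent k p) = if k = j then homogeneousComponent k p else 0 := by
  rw [homogeneousComponent_of_mem (homogeneousComponent_mem k p)]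
  simp [eq_comm]

/-- polynomials of degree less than `k` -/
def LT (σ K : Type*) [Field K] (k : ℕ) : Submodule K (MvPolynomial σ K) where
  carrier := {p | ∀ j, k ≤ j → homogeneousComponent j p = 0}
  add_mem' := by
    intro a b ha hb j hj
    simp [ha j hj, hb j hj]
  zero_mem' := by intro j _; simp
  smul_mem' := by
    intro c a ha j hj
    simp [ha j hj]

lemma mem_LT {k : ℕ} {p : MvPolynomial σ K} :
    p ∈ LT σ K k ↔ ∀ j, k ≤ j → homogeneousComponent j p = 0 := Iff.rfl

lemma LT_mono {k l : ℕ} (h : k ≤ l) : LT σ K k ≤ LT σ K l := fun _ hp j hj => hp j (h.trans hj)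

lemma mem_LT_totalDegree (p : MvPolynomial σ K) : p ∈ LT σ K (p.totalDegree + 1) :=
  fun _ hj => homogeneousComponent_eq_zero _ _ (by omega)

lemma eq_sum_of_mem_LT {k : ℕ} {p : MvPolynomial σ K} (hp : p ∈ LT σ K k) :
    p = ∑ i ∈ Finset.range k, homogeneousComponent i p := by
  conv_lhs => rw [← sum_homogeneousComponent p]
  by_cases h : k ≤ p.totalDegree + 1
  · symm
    apply Finset.sum_subset
    · intro i; simp; omega
    · intro i _ hi
      exact hp i (by simpa using hi)
  · apply Finset.sum_subset
    · intro i; simp; omega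
    · intro i _ hi
      exact mem_LT_totalDegree p i (by simpa using hi)

lemma totalDegree_le_of_mem_LT {k : ℕ} {p : MvPolynomial σ K} (hp : p ∈ LT σ K (k + 1)) :
    p.totalDegree ≤ k := by
  rw [eq_sum_of_mem_LT hp]
  apply totalDegree_finsetSum_le
  intro i hi
  have := (homogeneousComponent_isHomogeneous i p).totalDegree_le
  simp at hi; omega

lemma mem_LT_iff_totalDegree {k : ℕ} {p : MvPolynomial σ K} :
    p ∈ LT σ K (k + 1) ↔ p.totalDegree ≤ k :=
  ⟨totalDegree_le_of_mem_LT, fun h => LT_mono (by omega) (mem_LT_totalDegree p)⟩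

lemma mem_LT_zero {p : MvPolynomial σ K} : p ∈ LT σ K 0 ↔ p = 0 := by
  constructor
  · intro h; rw [eq_sum_of_mem_LT h]; simp
  · rintro rfl; exact zero_mem _

lemma mem_LT_of_homog {k : ℕ} {p : MvPolynomial σ K} (hp : p.IsHomogeneous k) :
    p ∈ LT σ K (k + 1) := mem_LT_iff_totalDegree.2 hp.totalDegree_le

lemma LT_mul {a b : ℕ} {p q : MvPolynomial σ K} (hp : p ∈ LT σ K a) (hq : q ∈ LT σ K (b + 1)) :
    p * q ∈ LT σ K (a + b) := by
  rcases a with _ | a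
  · rw [mem_LT_zero] at hp; subst hp; simp
  · rw [show a + 1 + b = (a + b) + 1 by ring]
    rw [mem_LT_iff_totalDegree] at *
    exact (totalDegree_mul _ _).trans (by omega)

lemma sub_hc_mem_LT {k : ℕ} {p : MvPolynomial σ K} (hp : p ∈ LT σ K (k + 1)) :
    p - homogeneousComponent k p ∈ LT σ K k := by
  intro j hj
  rw [map_sub, hc_hc]
  split_ifs with h
  · subst h; simp
  · rw [hp j (by omega)]; simp

instance [Finite σ] (k : ℕ) : FiniteDimensional K (LT σ K k) := by
  have : LT σ K k ≤ restrictTotalDegree σ K k := by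
    intro p hp
    rw [mem_restrictTotalDegree]
    exact totalDegree_le_of_mem_LT (LT_mono (by omega) hp)
  exact Submodule.finiteDimensional_of_le this

/-- reduction lemma -/
lemma reduce (J : Ideal (MvPolynomial σ K)) (M : ℕ)
    (h : ∀ k, M ≤ k → ∀ p : MvPolynomial σ K, p.IsHomogeneous k → ∃ q ∈ J, p - q ∈ LT σ K k)
    (p : MvPolynomial σ K) : ∃ r ∈ LT σ K M, p - r ∈ J := by
  have key : ∀ k, ∀ p ∈ LT σ K k, ∃ r ∈ LT σ K M, p - r ∈ J := by
    intro k
    induction k with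
    | zero => intro p hp; exact ⟨p, LT_mono (by omega) hp, by simp⟩
    | succ k ih =>
      intro p hp
      by_cases hk : k + 1 ≤ M
      · exact ⟨p, LT_mono hk hp, by simp⟩
      obtain ⟨q, hq, hpq⟩ := h k (by omega) _ (homogeneousComponent_isHomogeneous k p)
      obtain ⟨r, hr, hr'⟩ := ih (p - q) (by
        have := add_mem (sub_hc_mem_LT hp) hpq
        convert this using 1; ring)
      refine ⟨r, hr, ?_⟩
      have := add_mem hr' hq
      convert this using 1; ring
  exact key _ p (mem_LT_totalDegree p)

lemma finite_of_reduce [Finite σ] (J : Ideal (MvPolynomial σ K)) (M : ℕ)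
    (h : ∀ p : MvPolynomial σ K, ∃ r ∈ LT σ K M, p - r ∈ J) :
    Module.Finite K (MvPolynomial σ K ⧸ J) := by
  refine Module.Finite.of_surjective
    ((Ideal.Quotient.mkₐ K J).toLinearMap ∘ₗ (LT σ K M).subtype) ?_
  intro x
  obtain ⟨p, rfl⟩ := Ideal.Quotient.mk_surjective x
  obtain ⟨r, hr, hr'⟩ := h p
  exact ⟨⟨r, hr⟩, ((Ideal.Quotient.eq).2 hr').symm⟩

lemma top_forms {ι : Type*} [Fintype ι] (P T : ι → MvPolynomial σ K) (d : ι → ℕ)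
    (hT : ∀ i, (T i).IsHomogeneous (d i)) (hP : ∀ i, P i - T i ∈ LT σ K (d i)) {k : ℕ}
    {p : MvPolynomial σ K} (hp : p.IsHomogeneous k) (hps : p ∈ Ideal.span (Set.range T)) :
    ∃ q ∈ Ideal.span (Set.range P), p - q ∈ LT σ K k := by
  rw [Ideal.mem_span_range_iff_exists_fun] at hps
  obtain ⟨b, hb⟩ := hps
  let b' : ι → MvPolynomial σ K := fun i =>
    if d i ≤ k then homogeneousComponent (k - d i) (b i) else 0
  have h1 : p = ∑ i, b' i * T i := by
    rw [← homogeneousComponent_eq_self (n := k) (p := p) hp, ← hb, map_sum]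
    refine Finset.sum_congr rfl fun i _ => ?_
    simp only [b']
    split_ifs with h
    · obtain ⟨c, rfl⟩ := Nat.exists_eq_add_of_le' h
      rw [hc_mul (hT i)]; simp
    · rw [hc_mul_lt (hT i) _ (by omega)]; simp
  refine ⟨∑ i, b' i * P i, Ideal.sum_mem _ fun i _ => Ideal.mul_mem_left _ _
    (Ideal.subset_span ⟨i, rfl⟩), ?_⟩
  have h2 : p - ∑ i, b' i * P i = - ∑ i, (P i - T i) * b' i := by
    rw [h1, ← Finset.sum_sub_distrib, ← Finset.sum_neg_distrib]
    exact Finset.sum_congr rfl fun i _ => by ring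
  rw [h2]
  refine neg_mem (Submodule.sum_mem _ fun i _ => ?_)
  simp only [b']
  split_ifs with h
  · have := LT_mul (hP i) (mem_LT_of_homog (homogeneousComponent_isHomogeneous (k - d i) (b i)))
    rwa [Nat.add_sub_cancel' h] at this
  · simp

/-- projective Nullstellensatz -/
lemma proj_ns [Fintype σ] [IsAlgClosed K] {ι : Type*} (F : ι → MvPolynomial σ K)
    (h : ∀ v : σ → K, (∀ i, eval v (F i) = 0) → v = 0) :
    ∃ M, ∀ k, M ≤ k → ∀ p : MvPolynomial σ K, p.IsHomogeneous k →
      p ∈ Ideal.span (Set.range F) := by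
  set I := Ideal.span (Set.range F)
  have h1 : ∀ i : σ, ∃ n : ℕ, (X i : MvPolynomial σ K) ^ n ∈ I := by
    intro i
    have : (X i : MvPolynomial σ K) ∈ I.radical := by
      rw [← vanishingIdeal_zeroLocus_eq_radical (k := K) (K := K) I, mem_vanishingIdeal_iff]
      intro x hx
      have : x = 0 := by
        apply h
        intro j
        have := hx (F j) (Ideal.subset_span ⟨j, rfl⟩)
        simpa using this
      subst this; simp
    exact this
  choose n hn using h1
  refine ⟨∑ i, n i + 1, fun k hk p hp => ?_⟩
  rw [p.as_sum]
  refine Ideal.sum_mem _ fun m hm => ?_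
  have hdeg := hp.degree_eq_sum_deg_support hm
  obtain ⟨i, hi⟩ : ∃ i, n i ≤ m i := by
    by_contra hcon
    push Not at hcon
    have h1 : ∑ i ∈ m.support, m i = ∑ i, m i :=
      Finset.sum_subset (Finset.subset_univ _) (fun i _ h => by simpa using h)
    have : ∑ i, m i ≤ ∑ i, n i := Finset.sum_le_sum fun i _ => (hcon i).le
    rw [h1] at hdeg
    omega
  have : monomial m (coeff m p) = X i ^ n i * monomial (m - Finsupp.single i (n i)) (coeff m p) := by
    rw [X_pow_eq_monomial, monomial_mul, one_mul,
      add_tsub_cancel_of_le (Finsupp.single_le_iff.2 hi)]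
  rw [this]
  exact Ideal.mul_mem_right _ _ (hn i)

/-- Hilbert function (cumulative) -/
def HQ (I : Ideal (MvPolynomial σ K)) (M : ℕ) : Submodule K (MvPolynomial σ K ⧸ I) :=
  (LT σ K M).map (Ideal.Quotient.mkₐ K I).toLinearMap

instance [Finite σ] (I : Ideal (MvPolynomial σ K)) (M : ℕ) : FiniteDimensional K (HQ I M) := by
  unfold HQ; infer_instance

lemma lemmaH [Finite σ] (I : Ideal (MvPolynomial σ K))
    (hI : ∀ p ∈ I, ∀ k, homogeneousComponent k p ∈ I)
    (F T : MvPolynomial σ K) (d : ℕ) (hT : T.IsHomogeneous d) (hFT : F - T ∈ LT σ K d)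
    (hreg : ∀ q, q * T ∈ I → q ∈ I) (M₀ : ℕ)
    (hred : ∀ p : MvPolynomial σ K, ∃ r ∈ LT σ K M₀, p - r ∈ I ⊔ Ideal.span {F}) :
    Module.Finite K (MvPolynomial σ K ⧸ (I ⊔ Ideal.span {F})) ∧
    ∀ M, M₀ ≤ M + d → Module.finrank K (MvPolynomial σ K ⧸ (I ⊔ Ideal.span {F})) +
      Module.finrank K (HQ I M) = Module.finrank K (HQ I (M + d)) := by
  have hfin := finite_of_reduce _ _ hred
  refine ⟨hfin, fun M hM => ?_⟩
  -- key
  have key0 : ∀ k q i, q ∈ LT σ K (k + 1) → i ∈ I → q * F + i ∈ LT σ K (k + d) →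
      homogeneousComponent k q ∈ I := by
    intro k q i hq hi hqi
    apply hreg
    have e1 : q * F = q * T + q * (F - T) := by ring
    have e2 : homogeneousComponent (k + d) (q * (F - T)) = 0 := by
      rw [mul_comm]
      exact LT_mul hFT hq (k + d) (by omega)
    have := hqi (k + d) le_rfl
    rw [e1, map_add, map_add, e2, hc_mul hT, add_zero] at this
    rw [eq_neg_of_add_eq_zero_left this]
    exact neg_mem (hI _ hi _)
  have key1 : ∀ k q i, q ∈ LT σ K k → i ∈ I → q * F + i ∈ LT σ K (M + d) →
      ∃ q' ∈ LT σ K M, q - q' ∈ I := by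
    intro k
    induction k with
    | zero =>
      intro q i hq _ _
      exact ⟨q, LT_mono (by omega) hq, by simp⟩
    | succ k ih =>
      intro q i hq hi hqi
      by_cases hk : k + 1 ≤ M
      · exact ⟨q, LT_mono hk hq, by simp⟩
      have h1 := key0 k q i hq hi (LT_mono (by omega) hqi)
      obtain ⟨q', hq', hqq⟩ := ih (q - homogeneousComponent k q) (i + homogeneousComponent k q * F)
        (sub_hc_mem_LT hq) (add_mem hi (I.mul_mem_right _ h1)) (by
          convert hqi using 1; ring)
      refine ⟨q', hq', ?_⟩
      have := add_mem hqq h1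
      convert this using 1; ring
  have key2 : ∀ k q, q ∈ LT σ K k → q * F ∈ I → q ∈ I := by
    intro k
    induction k with
    | zero =>
      intro q hq _
      rw [mem_LT_zero] at hq; subst hq; simp
    | succ k ih =>
      intro q hq hqi
      have h1 := key0 k q (-(q * F)) hq (neg_mem hqi) (by simp)
      have := ih (q - homogeneousComponent k q) (sub_hc_mem_LT hq) (by
        rw [sub_mul]; exact sub_mem hqi (I.mul_mem_right _ h1))
      have := add_mem this h1
      simpa using this
  let A := MvPolynomial σ K ⧸ I
  let φ : A →ₐ[K] (MvPolynomial σ K ⧸ (I ⊔ Ideal.span {F})) :=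
    Ideal.Quotient.factorₐ K le_sup_left
  let ψ := φ.toLinearMap.domRestrict (HQ I (M + d))
  have hsurj : Function.Surjective ψ := by
    intro x
    obtain ⟨p, rfl⟩ := Ideal.Quotient.mk_surjective x
    obtain ⟨r, hr, hr'⟩ := hred p
    refine ⟨⟨Ideal.Quotient.mk I r, ⟨r, LT_mono hM hr, rfl⟩⟩, ?_⟩
    exact ((Ideal.Quotient.eq).2 hr').symm
  let mF : A →ₗ[K] A := LinearMap.mulRight K (Ideal.Quotient.mk I F)
  have hinj : Function.Injective mF := by
    rw [injective_iff_map_eq_zero]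
    intro x hx
    obtain ⟨q, rfl⟩ := Ideal.Quotient.mk_surjective x
    have : q * F ∈ I := by
      rw [← Ideal.Quotient.eq_zero_iff_mem, map_mul]; exact hx
    exact Ideal.Quotient.eq_zero_iff_mem.2 (key2 _ q (mem_LT_totalDegree q) this)
  have hker : (LinearMap.ker ψ).map (HQ I (M + d)).subtype = (HQ I M).map mF := by
    ext x
    constructor
    · rintro ⟨⟨y, hy⟩, hy', rfl⟩
      obtain ⟨p, hp, rfl⟩ := hy
      have h1 : p ∈ I ⊔ Ideal.span {F} := by
        rw [← Ideal.Quotient.eq_zero_iff_mem]; exact hy'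
      obtain ⟨i, hi, z, hz, hiz⟩ := Submodule.mem_sup.1 h1
      obtain ⟨q, rfl⟩ := Ideal.mem_span_singleton'.1 hz
      obtain ⟨q', hq', hqq⟩ := key1 _ q i (mem_LT_totalDegree q) hi (by
        rw [add_comm (q * F) i, hiz]; exact hp)
      refine ⟨Ideal.Quotient.mk I q', ⟨q', hq', rfl⟩, ?_⟩
      change Ideal.Quotient.mk I q' * Ideal.Quotient.mk I F = Ideal.Quotient.mk I p
      rw [← map_mul, Ideal.Quotient.eq, ← hiz]
      have := sub_mem (neg_mem (I.mul_mem_right F hqq)) hi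
      convert this using 1; ring
    · rintro ⟨y, ⟨q, hq, rfl⟩, rfl⟩
      have hF : F ∈ LT σ K (d + 1) := by
        have := add_mem (LT_mono (Nat.le_succ d) hFT) (mem_LT_of_homog hT)
        simpa using this
      refine ⟨⟨Ideal.Quotient.mk I (q * F), ⟨q * F, LT_mul hq hF, rfl⟩⟩, ?_, ?_⟩
      · change Ideal.Quotient.mk (I ⊔ Ideal.span {F}) (q * F) = 0
        rw [Ideal.Quotient.eq_zero_iff_mem]
        exact Ideal.mul_mem_left _ _ (Ideal.mem_sup_right (Ideal.mem_span_singleton_self F))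
      · exact map_mul (Ideal.Quotient.mk I) q F
  have h1 := LinearMap.finrank_range_add_finrank_ker ψ
  rw [LinearMap.range_eq_top.2 hsurj, finrank_top] at h1
  rw [← h1]
  congr 1
  rw [(Submodule.equivMapOfInjective mF hinj (HQ I M)).finrank_eq, ← hker]
  exact (Submodule.equivMapOfInjective _ (Submodule.injective_subtype _) _).finrank_eq.symm

end Basic
end Bez
end

open MvPolynomial
noncomputable section
namespace Bez
section Kos
variable {K : Type*} [Field K]

/-- the family `F` has only trivial (Koszul) relations -/
def KosP {R ι : Type*} [CommRing R] [Fintype ι] (F : ι → R) : Prop :=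
  ∀ a : ι → R, ∑ i, a i * F i = 0 → ∃ k : ι → ι → R, ∀ i, a i = ∑ j, (k i j - k j i) * F j

lemma kos_sum {R ι : Type*} [CommRing R] [Fintype ι] (F : ι → R) (k : ι → ι → R) :
    ∑ i, (∑ j, (k i j - k j i) * F j) * F i = 0 := by
  simp only [sub_mul, Finset.sum_sub_distrib, Finset.sum_mul]
  rw [sub_eq_zero, Finset.sum_comm]
  refine Finset.sum_congr rfl fun i _ => Finset.sum_congr rfl fun j _ => by ring

lemma kos_cons {R : Type*} [CommRing R] {N : ℕ} (F : Fin (N + 1) → R)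
    (h : KosP (fun i : Fin N => F i.succ))
    (hreg : ∀ q, q * F 0 ∈ Ideal.span (Set.range fun i : Fin N => F i.succ) →
      q ∈ Ideal.span (Set.range fun i : Fin N => F i.succ)) : KosP F := by
  intro a ha
  rw [Fin.sum_univ_succ] at ha
  have h0 : a 0 ∈ Ideal.span (Set.range fun i : Fin N => F i.succ) := by
    apply hreg
    rw [eq_neg_of_add_eq_zero_left ha]
    exact neg_mem (Ideal.sum_mem _ fun i _ => Ideal.mul_mem_left _ _ (Ideal.subset_span ⟨i, rfl⟩))
  obtain ⟨c, hc⟩ := Ideal.mem_span_range_iff_exists_fun.1 h0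
  obtain ⟨k, hk⟩ := h (fun j => a j.succ + c j * F 0) (by
    rw [← ha, ← hc, Finset.sum_mul, ← Finset.sum_add_distrib]
    exact Finset.sum_congr rfl fun i _ => by ring)
  refine ⟨Fin.cons (Fin.cons 0 c) (fun i => Fin.cons 0 (k i)), fun i => ?_⟩
  refine Fin.cases ?_ (fun i => ?_) i
  · rw [Fin.sum_univ_succ]; simp [hc]
  · rw [Fin.sum_univ_succ]
    simp only [Fin.cons_succ, Fin.cons_zero]
    rw [← hk i]; ring

/-- truncation -/
def tr {σ : Type*} (M : ℕ) (p : MvPolynomial σ K) : MvPolynomial σ K :=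
  ∑ i ∈ Finset.range M, homogeneousComponent i p

variable {σ : Type*}
lemma hc_tr (M j : ℕ) (p : MvPolynomial σ K) :
    homogeneousComponent j (tr M p) = if j < M then homogeneousComponent j p else 0 := by
  simp only [tr, map_sum, hc_hc]
  simp

lemma tr_mem (M : ℕ) (p : MvPolynomial σ K) : tr M p ∈ LT σ K M := by
  intro j hj
  rw [hc_tr, if_neg (by omega)]

lemma ext_hc {p q : MvPolynomial σ K}
    (h : ∀ j, homogeneousComponent j p = homogeneousComponent j q) : p = q := by
  rw [← sub_eq_zero, ← mem_LT_zero]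
  intro j _
  rw [map_sub, h, sub_self]

lemma tr_of_mem {M : ℕ} {p : MvPolynomial σ K} (h : p ∈ LT σ K M) : tr M p = p :=
  (eq_sum_of_mem_LT h).symm

lemma tr_mul {F : MvPolynomial σ K} {d : ℕ} (hF : F.IsHomogeneous d) (M : ℕ)
    (p : MvPolynomial σ K) : tr M (p * F) = tr (M - d) p * F := by
  apply ext_hc
  intro j
  rw [hc_tr]
  by_cases hj : d ≤ j
  · obtain ⟨c, rfl⟩ := Nat.exists_eq_add_of_le' hj
    rw [hc_mul hF, hc_mul hF, hc_tr]
    by_cases h : c + d < M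
    · rw [if_pos h, if_pos (by omega)]
    · rw [if_neg h, if_neg (by omega), zero_mul]
  · rw [hc_mul_lt hF _ (by omega), hc_mul_lt hF _ (by omega), ite_self]

lemma tr_sum {ι : Type*} (s : Finset ι) (M : ℕ) (p : ι → MvPolynomial σ K) :
    tr M (∑ i ∈ s, p i) = ∑ i ∈ s, tr M (p i) := by
  simp only [tr, map_sum]; rw [Finset.sum_comm]

lemma tr_sub (M : ℕ) (p q : MvPolynomial σ K) :
    tr M (p - q) = tr M p - tr M q := by
  simp only [tr, map_sub, Finset.sum_sub_distrib]

lemma LT_mul_sub {F : MvPolynomial σ K} {d : ℕ} (hF : F.IsHomogeneous d) {M : ℕ}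
    {p : MvPolynomial σ K} (hp : p ∈ LT σ K (M - d)) : p * F ∈ LT σ K M := by
  have := tr_mem M (p * F)
  rwa [tr_mul hF, tr_of_mem hp] at this

lemma LT_of_mul {F : MvPolynomial σ K} {d : ℕ} (hF : F.IsHomogeneous d) (h0 : F ≠ 0) {M : ℕ}
    {p : MvPolynomial σ K} (hp : p * F ∈ LT σ K M) : p ∈ LT σ K (M - d) := by
  intro j hj
  have := hp (j + d) (by omega)
  rw [hc_mul hF] at this
  exact (mul_eq_zero.1 this).resolve_right h0

variable {N : ℕ}

/-- substitution `X 0 ↦ L` -/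
def sb (L : MvPolynomial (Fin N) K) : MvPolynomial (Fin (N + 1)) K →ₐ[K] MvPolynomial (Fin N) K :=
  aeval (Fin.cons L X : Fin (N + 1) → MvPolynomial (Fin N) K)

/-- section -/
abbrev rs : MvPolynomial (Fin N) K →ₐ[K] MvPolynomial (Fin (N + 1)) K := rename Fin.succ

/-- linear form -/
def ell (L : MvPolynomial (Fin N) K) : MvPolynomial (Fin (N + 1)) K := X 0 - rs L

lemma sb_rs (L p : MvPolynomial (Fin N) K) : sb L (rs p) = p := by
  rw [sb, rs, aeval_rename]
  have : (Fin.cons L X : Fin (N + 1) → MvPolynomial (Fin N) K) ∘ Fin.succ = X := by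
    ext1 i; simp
  rw [this]; simp

lemma sb_ell (L : MvPolynomial (Fin N) K) : sb L (ell L) = 0 := by
  rw [ell, map_sub, sb_rs]; simp [sb]

lemma sb_ker (L : MvPolynomial (Fin N) K) (p : MvPolynomial (Fin (N + 1)) K) :
    ∃ q, p = rs (sb L p) + ell L * q := by
  have : (Ideal.Quotient.mkₐ K (Ideal.span {ell L})).comp (rs.comp (sb L)) =
      Ideal.Quotient.mkₐ K (Ideal.span {ell L}) := by
    apply algHom_ext
    intro i
    refine Fin.cases ?_ (fun i => ?_) i
    · simp only [AlgHom.comp_apply]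
      symm
      refine (Ideal.Quotient.eq).2 ?_
      rw [Ideal.mem_span_singleton]
      simp [sb, ell]
    · simp [sb]
  have h := DFunLike.congr_fun this p
  have h2 : p - rs (sb L p) ∈ Ideal.span {ell L} := (Ideal.Quotient.eq).1 h.symm
  obtain ⟨q, hq⟩ := Ideal.mem_span_singleton.1 h2
  exact ⟨q, by rw [← hq]; ring⟩

lemma ell_homog {L : MvPolynomial (Fin N) K} (hL : L.IsHomogeneous 1) : (ell L).IsHomogeneous 1 :=
  (isHomogeneous_X _ _).sub (hL.rename_isHomogeneous)

lemma ell_ne {L : MvPolynomial (Fin N) K} : ell L ≠ 0 := by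
  intro h
  have := congrArg (aeval (Fin.cons (L + 1) X : Fin (N + 1) → MvPolynomial (Fin N) K)) h
  rw [ell, rs, map_sub, aeval_rename] at this
  have h2 : (Fin.cons (L + 1) X : Fin (N + 1) → MvPolynomial (Fin N) K) ∘ Fin.succ = X := by
    ext1 i; simp
  rw [h2] at this
  simp at this

lemma sb_homog {L : MvPolynomial (Fin N) K} (hL : L.IsHomogeneous 1)
    {p : MvPolynomial (Fin (N + 1)) K} {d : ℕ} (hp : p.IsHomogeneous d) :
    (sb L p).IsHomogeneous d := by
  have := hp.aeval (Fin.cons L X : Fin (N + 1) → MvPolynomial (Fin N) K) (n := 1) (fun i => by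
    refine Fin.cases ?_ (fun i => ?_) i
    · simpa
    · simpa using isHomogeneous_X _ _)
  simpa [sb] using this

lemma rs_LT {M : ℕ} {p : MvPolynomial (Fin N) K} (hp : p ∈ LT _ K M) : rs p ∈ LT (Fin (N+1)) K M := by
  rcases M with _ | M
  · rw [mem_LT_zero] at *; simp [hp]
  · rw [mem_LT_iff_totalDegree] at *
    exact (totalDegree_rename_le _ _).trans hp

lemma sb_LT {L : MvPolynomial (Fin N) K} (hL : L.IsHomogeneous 1) {M : ℕ}
    {p : MvPolynomial (Fin (N+1)) K} (hp : p ∈ LT _ K M) : sb L p ∈ LT (Fin N) K M := by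
  rw [eq_sum_of_mem_LT hp, map_sum]
  refine Submodule.sum_mem _ fun i hi => ?_
  exact LT_mono (Finset.mem_range.1 hi) (mem_LT_of_homog (sb_homog hL (homogeneousComponent_isHomogeneous i p)))

variable {ι : Type*} [Fintype ι] {L : MvPolynomial (Fin N) K}
  {F : ι → MvPolynomial (Fin (N + 1)) K}

lemma kos_step (hk : KosP (fun i => sb L (F i))) (a : ι → MvPolynomial (Fin (N + 1)) K)
    (ha : sb L (∑ i, a i * F i) = 0) : ∃ k : ι → ι → MvPolynomial (Fin N) K, ∀ i, sb L (a i) = ∑ j, (k i j - k j i) * sb L (F j) := by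
  apply hk
  rw [← ha]; simp

/-- (a) -/
lemma ell_reg (hk : KosP (fun i => sb L (F i))) (u : MvPolynomial (Fin (N + 1)) K)
    (hu : u * ell L ∈ Ideal.span (Set.range F)) : u ∈ Ideal.span (Set.range F) := by
  obtain ⟨a, ha⟩ := Ideal.mem_span_range_iff_exists_fun.1 hu
  obtain ⟨k, hk⟩ := kos_step hk a (by rw [ha, map_mul, sb_ell, mul_zero])
  have h1 : ∀ i, ∃ b, a i = ∑ j, (rs (k i j) - rs (k j i)) * F j + b * ell L := by
    intro i
    obtain ⟨q, hq⟩ := sb_ker L (a i - ∑ j, (rs (k i j) - rs (k j i)) * F j)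
    refine ⟨q, ?_⟩
    rw [map_sub, hk, map_sum] at hq
    simp only [map_mul, map_sub, sb_rs, sub_self, map_zero, zero_add] at hq
    rw [mul_comm q, ← hq]; ring
  choose b hb using h1
  have h2 : u * ell L = (∑ i, b i * F i) * ell L := by
    rw [← ha]
    have : ∀ i, a i * F i = (∑ j, (rs (k i j) - rs (k j i)) * F j) * F i + b i * F i * ell L := by
      intro i; rw [hb i]; ring
    simp only [this, Finset.sum_add_distrib]
    rw [kos_sum F (fun i j => rs (k i j)), zero_add, Finset.sum_mul]
  rw [mul_right_cancel₀ ell_ne h2]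
  exact Ideal.sum_mem _ fun i _ => Ideal.mul_mem_left _ _ (Ideal.subset_span ⟨i, rfl⟩)

/-- (b) -/
lemma kos_lift (hL : L.IsHomogeneous 1) {d : ι → ℕ} (hF : ∀ i, (F i).IsHomogeneous (d i))
    (hk : KosP (fun i => sb L (F i))) : KosP F := by
  have key : ∀ B, ∀ a : ι → MvPolynomial (Fin (N + 1)) K, (∀ i, a i ∈ LT _ K (B - d i)) →
      ∑ i, a i * F i = 0 → ∃ k : ι → ι → _, ∀ i, a i = ∑ j, (k i j - k j i) * F j := by
    intro B
    induction B with
    | zero =>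
      intro a ha _
      refine ⟨0, fun i => ?_⟩
      have := ha i
      rw [Nat.zero_sub, mem_LT_zero] at this
      simp [this]
    | succ B ih =>
      intro a ha h0
      obtain ⟨k0, hk0⟩ := kos_step hk a (by rw [h0, map_zero])
      let k : ι → ι → MvPolynomial (Fin N) K := fun i j => tr (B + 1 - d i - d j) (k0 i j)
      have hk : ∀ i, sb L (a i) = ∑ j, (k i j - k j i) * sb L (F j) := by
        intro i
        rw [← tr_of_mem (sb_LT hL (ha i)), hk0, tr_sum]
        refine Finset.sum_congr rfl fun j _ => ?_
        rw [tr_mul (sb_homog hL (hF j)), tr_sub]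
        simp only [k]
        rw [Nat.sub_right_comm (B + 1) (d j) (d i)]
      have h1 : ∀ i, ∃ b, a i = ∑ j, (rs (k i j) - rs (k j i)) * F j + b * ell L := by
        intro i
        obtain ⟨q, hq⟩ := sb_ker L (a i - ∑ j, (rs (k i j) - rs (k j i)) * F j)
        refine ⟨q, ?_⟩
        rw [map_sub, hk, map_sum] at hq
        simp only [map_mul, map_sub, sb_rs, sub_self, map_zero, zero_add] at hq
        rw [mul_comm q, ← hq]; ring
      choose b hb using h1
      obtain ⟨k', hk'⟩ := ih b (by
        intro i
        have : b i * ell L ∈ LT _ K (B + 1 - d i) := by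
          rw [← sub_eq_iff_eq_add'.2 (hb i)]
          refine sub_mem (ha i) (Submodule.sum_mem _ fun j _ => ?_)
          apply LT_mul_sub (hF j)
          refine sub_mem (rs_LT (tr_mem _ _)) (rs_LT ?_)
          rw [Nat.sub_right_comm]
          exact tr_mem _ _
        have := LT_of_mul (ell_homog hL) ell_ne this
        rwa [show B + 1 - d i - 1 = B - d i by omega] at this) (by
        have : (∑ i, b i * F i) * ell L = 0 := by
          rw [← h0]
          have : ∀ i, a i * F i = (∑ j, (rs (k i j) - rs (k j i)) * F j) * F i + b i * F i * ell L := by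
            intro i; rw [hb i]; ring
          simp only [this, Finset.sum_add_distrib]
          rw [kos_sum F (fun i j => rs (k i j)), zero_add, Finset.sum_mul]
        exact (mul_eq_zero.1 this).resolve_right ell_ne)
      refine ⟨fun i j => rs (k i j) + k' i j * ell L, fun i => ?_⟩
      conv_lhs => rw [hb i, hk' i]
      rw [Finset.sum_mul, ← Finset.sum_add_distrib]
      exact Finset.sum_congr rfl fun j _ => by ring
  intro a ha
  refine key (∑ i, ((a i).totalDegree + 1 + d i)) a (fun i => ?_) ha
  refine LT_mono ?_ (mem_LT_totalDegree _)
  have := Finset.single_le_sum (f := fun i => (a i).totalDegree + 1 + d i) (fun _ _ => Nat.zero_le _)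
    (Finset.mem_univ i)
  omega

/-- (c) -/
def quotEquiv (L : MvPolynomial (Fin N) K) (F : ι → MvPolynomial (Fin (N + 1)) K) :
    (MvPolynomial (Fin (N + 1)) K ⧸ (Ideal.span (Set.range F) ⊔ Ideal.span {ell L})) ≃ₐ[K]
      (MvPolynomial (Fin N) K ⧸ Ideal.span (Set.range fun i => sb L (F i))) :=
  AlgEquiv.ofAlgHom
    (Ideal.Quotient.liftₐ _ ((Ideal.Quotient.mkₐ K _).comp (sb L)) (by
      have : Ideal.span (Set.range F) ⊔ Ideal.span {ell L} ≤ RingHom.ker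
        ((Ideal.Quotient.mkₐ K (Ideal.span (Set.range fun i => sb L (F i)))).comp (sb L)) := by
        rw [sup_le_iff, Ideal.span_le, Ideal.span_le]
        constructor
        · rintro _ ⟨i, rfl⟩
          exact Ideal.Quotient.eq_zero_iff_mem.2 (Ideal.subset_span ⟨i, rfl⟩)
        · rintro _ rfl
          simp [RingHom.mem_ker, sb_ell]
      exact fun a ha => this ha))
    (Ideal.Quotient.liftₐ _ ((Ideal.Quotient.mkₐ K _).comp rs) (by
      have : Ideal.span (Set.range fun i => sb L (F i)) ≤ RingHom.ker
        ((Ideal.Quotient.mkₐ K (Ideal.span (Set.range F) ⊔ Ideal.span {ell L})).comp rs) := by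
        rw [Ideal.span_le]
        rintro _ ⟨i, rfl⟩
        refine Ideal.Quotient.eq_zero_iff_mem.2 ?_
        obtain ⟨q, hq⟩ := sb_ker L (F i)
        have : rs (sb L (F i)) = F i - q * ell L := by rw [hq]; simp [sb_rs, sb_ell]; ring
        change rs (sb L (F i)) ∈ _
        rw [this]
        exact sub_mem (Ideal.mem_sup_left (Ideal.subset_span ⟨i, rfl⟩))
          (Ideal.mul_mem_left _ _ (Ideal.mem_sup_right (Ideal.mem_span_singleton_self _)))
      exact fun a ha => this ha))
    (by
      apply Ideal.Quotient.algHom_ext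
      apply AlgHom.ext
      intro p
      change Ideal.Quotient.mk _ (sb L (rs p)) = Ideal.Quotient.mk _ p
      rw [sb_rs])
    (by
      apply Ideal.Quotient.algHom_ext
      apply AlgHom.ext
      intro p
      obtain ⟨q, hq⟩ := sb_ker L p
      have : p - rs (sb L p) ∈ (Ideal.span (Set.range F) ⊔ Ideal.span {ell L}) := by
        have h : p - rs (sb L p) = q * ell L := by rw [mul_comm]; exact sub_eq_iff_eq_add'.2 hq
        rw [h]
        exact (Ideal.mul_mem_left _ _ (Ideal.mem_sup_right (Ideal.mem_span_singleton_self _)))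
      exact ((Ideal.Quotient.eq).2 this).symm)

end Kos
end Bez
end

open MvPolynomial
noncomputable section
namespace Bez
section B
variable {K : Type*} [Field K] {σ : Type*}

lemma finite_zeros (J : Ideal (MvPolynomial σ K)) [Module.Finite K (MvPolynomial σ K ⧸ J)] :
    {v : σ → K | ∀ p ∈ J, eval v p = 0}.Finite := by
  let φ : {v : σ → K | ∀ p ∈ J, eval v p = 0} → ((MvPolynomial σ K ⧸ J) →ₐ[K] K) := fun v =>
    Ideal.Quotient.liftₐ J (aeval v.1) (fun p hp => by simpa using v.2 p hp)
  have : Function.Injective φ := by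
    intro v w h
    ext i
    have := DFunLike.congr_fun h (Ideal.Quotient.mk J (X i))
    simpa [φ] using this
  exact Finite.of_injective φ this

lemma exists_avoid [Infinite K] {N : ℕ} (Z : Set (Fin (N + 1) → K)) (hZ : Z.Finite)
    (h0 : ∀ v ∈ Z, v ≠ 0) : ∃ c : Fin N → K, ∀ v ∈ Z, v 0 - ∑ i, c i * v i.succ ≠ 0 := by
  let P : (Fin (N + 1) → K) → MvPolynomial (Fin N) K := fun v =>
    C (v 0) - ∑ i, X i * C (v i.succ)
  have hP : ∀ v ∈ Z, P v ≠ 0 := by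
    intro v hv h
    apply h0 v hv
    have h1 := congrArg (eval (0 : Fin N → K)) h
    simp [P] at h1
    ext i
    refine Fin.cases ?_ (fun i => ?_) i
    · simpa using h1
    · have h2 := congrArg (eval (Pi.single i 1 : Fin N → K)) h
      simp [P, h1, Pi.single_apply] at h2
      simpa using h2
  have hprod : ∏ v ∈ hZ.toFinset, P v ≠ 0 :=
    Finset.prod_ne_zero_iff.2 fun v hv => hP v (by simpa using hv)
  obtain ⟨c, hc⟩ : ∃ c : Fin N → K, eval c (∏ v ∈ hZ.toFinset, P v) ≠ 0 := by
    by_contra hcon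
    push Not at hcon
    exact hprod (MvPolynomial.funext fun x => by rw [hcon x, map_zero])
  refine ⟨c, fun v hv => ?_⟩
  rw [map_prod, Finset.prod_ne_zero_iff] at hc
  have := hc v (by simpa using hv)
  simpa [P] using this

lemma eval_smul_homog {p : MvPolynomial σ K} {d : ℕ} (hp : p.IsHomogeneous d) (r : K) (v : σ → K) :
    eval (r • v) p = r ^ d * eval v p := by
  rw [eval_eq, eval_eq, Finset.mul_sum]
  refine Finset.sum_congr rfl fun m hm => ?_
  have := hp.degree_eq_sum_deg_support hm
  simp only [Pi.smul_apply, smul_eq_mul, mul_pow]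
  rw [Finset.prod_mul_distrib, Finset.prod_pow_eq_pow_sum, ← this]; ring

lemma span_cons {R : Type*} [CommRing R] {N : ℕ} (F : Fin (N + 1) → R) :
    Ideal.span (Set.range F) = Ideal.span (Set.range fun i : Fin N => F i.succ) ⊔ Ideal.span {F 0} := by
  rw [← Ideal.span_union]
  congr 1
  ext x
  simp only [Set.mem_range, Set.mem_union, Set.mem_singleton_iff]
  rw [Fin.exists_fin_succ, or_comm]
  simp [eq_comm]

lemma span_hc {ι : Type*} [Fintype ι] {F : ι → MvPolynomial σ K} {d : ι → ℕ}
    (hF : ∀ i, (F i).IsHomogeneous (d i)) :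
    ∀ p ∈ Ideal.span (Set.range F), ∀ k, homogeneousComponent k p ∈ Ideal.span (Set.range F) := by
  intro p hp k
  obtain ⟨a, rfl⟩ := Ideal.mem_span_range_iff_exists_fun.1 hp
  rw [map_sum]
  refine Ideal.sum_mem _ fun i _ => ?_
  by_cases h : d i ≤ k
  · obtain ⟨c, rfl⟩ := Nat.exists_eq_add_of_le' h
    rw [hc_mul (hF i)]
    exact Ideal.mul_mem_left _ _ (Ideal.subset_span ⟨i, rfl⟩)
  · rw [hc_mul_lt (hF i) _ (by omega)]; exact zero_mem _

/-- finite-dimensionality from top forms without nontrivial zero -/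
lemma reduce_top [IsAlgClosed K] [Fintype σ] {ι : Type*} [Fintype ι] (P T : ι → MvPolynomial σ K)
    (d : ι → ℕ) (hT : ∀ i, (T i).IsHomogeneous (d i)) (hP : ∀ i, P i - T i ∈ LT σ K (d i))
    (h : ∀ v : σ → K, (∀ i, eval v (T i) = 0) → v = 0) :
    ∃ M, ∀ p : MvPolynomial σ K, ∃ r ∈ LT σ K M, p - r ∈ Ideal.span (Set.range P) := by
  obtain ⟨M, hM⟩ := proj_ns T h
  exact ⟨M, reduce _ M fun k hk p hp => top_forms P T d hT hP hp (hM k hk p hp)⟩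

lemma HQ_mul {I : Ideal (MvPolynomial σ K)} {r M : ℕ}
    (h : ∀ M', M ≤ M' → r + Module.finrank K (HQ I M') = Module.finrank K (HQ I (M' + 1))) (d : ℕ) :
    d * r + Module.finrank K (HQ I M) = Module.finrank K (HQ I (M + d)) := by
  induction d with
  | zero => simp
  | succ d ih =>
    have := h (M + d) (by omega)
    rw [← add_assoc, ← this, ← ih]; ring

lemma eval_sb {N : ℕ} (L : MvPolynomial (Fin N) K) (p : MvPolynomial (Fin (N + 1)) K) (w : Fin N → K) :
    eval w (sb L p) = eval (Fin.cons (eval w L) w : Fin (N + 1) → K) p := by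
  have : (aeval w : MvPolynomial (Fin N) K →ₐ[K] K).comp (sb L) =
    aeval (Fin.cons (eval w L) w : Fin (N + 1) → K) := by
    apply algHom_ext
    intro i
    refine Fin.cases ?_ (fun i => ?_) i
    · simp [sb]
    · simp [sb]
  have := DFunLike.congr_fun this p
  simpa using this

lemma eval_ell {N : ℕ} (L : MvPolynomial (Fin N) K) (v : Fin (N + 1) → K) :
    eval v (ell L) = v 0 - eval (fun i => v i.succ) L := by
  simp only [ell, rs, map_sub, eval_X, eval_rename]; rfl

/-- part common to the two uses -/
lemma ell_part [IsAlgClosed K] {N : ℕ} {ι : Type*} [Fintype ι]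
    (F : ι → MvPolynomial (Fin (N + 1)) K) (d : ι → ℕ)
    (hF : ∀ i, (F i).IsHomogeneous (d i)) (L : MvPolynomial (Fin N) K) (hL : L.IsHomogeneous 1)
    (h0 : ∀ w : Fin N → K, (∀ i, eval w (sb L (F i)) = 0) → w = 0)
    (hk : KosP fun i => sb L (F i)) (P : MvPolynomial (Fin (N + 1)) K)
    (hP : P - ell L ∈ LT _ K 1) :
    ∃ M, Module.Finite K (MvPolynomial (Fin (N + 1)) K ⧸ (Ideal.span (Set.range F) ⊔ Ideal.span {P})) ∧
    ∀ M', M ≤ M' →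
      Module.finrank K (MvPolynomial (Fin (N + 1)) K ⧸ (Ideal.span (Set.range F) ⊔ Ideal.span {P})) +
      Module.finrank K (HQ (Ideal.span (Set.range F)) M') =
        Module.finrank K (HQ (Ideal.span (Set.range F)) (M' + 1)) := by
  let T' : Option ι → MvPolynomial (Fin (N + 1)) K := fun o => o.elim (ell L) F
  let P' : Option ι → MvPolynomial (Fin (N + 1)) K := fun o => o.elim P F
  let d' : Option ι → ℕ := fun o => o.elim 1 d
  obtain ⟨M, hM⟩ := reduce_top P' T' d' (by
      rintro (_ | i)
      · exact ell_homog hL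
      · exact hF i) (by
      rintro (_ | i)
      · exact hP
      · simp [P', T']) (by
      intro v hv
      have h1 := hv none
      simp only [T', Option.elim, eval_ell] at h1
      have h2 : (Fin.cons (eval (fun i => v (Fin.succ i)) L) (fun i => v (Fin.succ i)) : Fin (N + 1) → K) = v := by
        ext i
        refine Fin.cases ?_ (fun i => ?_) i
        · simp [sub_eq_zero.1 h1]
        · simp
      have h3 := h0 (fun i => v i.succ) (fun i => by
        rw [eval_sb, h2]; exact hv (some i))
      rw [← h2, h3]
      ext i
      refine Fin.cases ?_ (fun i => ?_) i
      · simp only [Fin.cons_zero, Pi.zero_apply]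
        have := eval_smul_homog hL (0 : K) (0 : Fin N → K)
        simpa using this
      · simp)
  have hspan : Ideal.span (Set.range P') = Ideal.span (Set.range F) ⊔ Ideal.span {P} := by
    rw [← Ideal.span_union]
    congr 1
    ext x
    simp only [Set.mem_range, Set.mem_union, Set.mem_singleton_iff, Option.exists, P', Option.elim]
    rw [or_comm]; simp [eq_comm]
  rw [hspan] at hM
  have := lemmaH (Ideal.span (Set.range F)) (span_hc hF) P (ell L) 1 (ell_homog hL) hP
    (ell_reg hk) M hM
  exact ⟨M, this.1, fun M' h => this.2 M' (by omega)⟩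

theorem bezout [IsAlgClosed K] : ∀ (N : ℕ) (F : Fin N → MvPolynomial (Fin N) K) (d : Fin N → ℕ),
    (∀ i, (F i).IsHomogeneous (d i)) → (∀ i, 1 ≤ d i) →
    (∀ v : Fin N → K, (∀ i, eval v (F i) = 0) → v = 0) →
    KosP F ∧ Module.Finite K (MvPolynomial (Fin N) K ⧸ Ideal.span (Set.range F)) ∧
      Module.finrank K (MvPolynomial (Fin N) K ⧸ Ideal.span (Set.range F)) = ∏ i, d i := by
  intro N
  induction N with
  | zero =>
    intro F d _ _ _
    refine ⟨fun a _ => ⟨fun _ _ => 0, fun i => i.elim0⟩, ?_⟩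
    have : Ideal.span (Set.range F) = ⊥ := by
      rw [Set.range_eq_empty]; simp
    rw [this]
    let e := (AlgEquiv.quotientBot K (MvPolynomial (Fin 0) K)).trans (isEmptyAlgEquiv K (Fin 0))
    refine ⟨Module.Finite.equiv e.symm.toLinearEquiv, ?_⟩
    rw [e.toLinearEquiv.finrank_eq]
    simp
  | succ N ih =>
    intro F d hF hd h0
    have := IsAlgClosed.instInfinite (K := K)
    let G : Fin N → MvPolynomial (Fin (N + 1)) K := fun i => F i.succ
    set I := Ideal.span (Set.range G) with hI
    have hspan : Ideal.span (Set.range F) = I ⊔ Ideal.span {F 0} := span_cons F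
    -- finitely many zeros with F 0 = 1
    let P' : Fin (N + 1) → MvPolynomial (Fin (N + 1)) K := Fin.cons (F 0 - 1) G
    obtain ⟨M, hM⟩ := reduce_top P' F d hF (by
      intro i
      refine Fin.cases ?_ (fun i => ?_) i
      · simp only [P', Fin.cons_zero, sub_sub_cancel_left]
        refine LT_mono (hd 0) (neg_mem (mem_LT_of_homog (isHomogeneous_one _ _)))
      · simp [P', G]) h0
    have hfin := finite_of_reduce _ _ hM
    have hZ := finite_zeros (Ideal.span (Set.range P'))
    obtain ⟨c, hc⟩ := exists_avoid _ hZ (by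
      rintro v hv rfl
      have := hv (P' 0) (Ideal.subset_span ⟨0, rfl⟩)
      have h2 := eval_smul_homog (hF 0) (0 : K) (0 : Fin (N + 1) → K)
      rw [zero_pow (by have := hd 0; omega)] at h2
      simp [P'] at this h2
      simp [h2] at this)
    let L : MvPolynomial (Fin N) K := ∑ i, C (c i) * X i
    have hL : L.IsHomogeneous 1 := IsHomogeneous.sum _ _ _ fun i _ => isHomogeneous_C_mul_X _ _
    have hGz : ∀ w : Fin N → K, (∀ i, eval w (sb L (G i)) = 0) → w = 0 := by
      intro w hw
      simp only [eval_sb] at hw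
      set v : Fin (N + 1) → K := Fin.cons (eval w L) w with hv
      suffices v = 0 by
        ext i
        have := congrFun this i.succ
        simpa [hv] using this
      by_contra hne
      have hF0 : eval v (F 0) ≠ 0 := by
        intro h
        apply hne
        apply h0
        intro i
        refine Fin.cases h (fun i => ?_) i
        exact hw i
      obtain ⟨r, hr⟩ := IsAlgClosed.exists_pow_nat_eq (eval v (F 0))⁻¹ (n := d 0) (hd 0)
      have := hc (r • v) (by
        intro p hp
        have : Ideal.span (Set.range P') ≤ RingHom.ker (eval (r • v)) := by
          rw [Ideal.span_le]
          rintro _ ⟨i, rfl⟩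
          refine Fin.cases ?_ (fun i => ?_) i
          · simp [P', eval_smul_homog (hF 0), hr, hF0, RingHom.mem_ker]
          · simp [P', G, eval_smul_homog (hF _), RingHom.mem_ker]
            right; exact hw i
        exact this hp)
      apply this
      simp [hv, L, Finset.mul_sum]
      rw [sub_eq_zero]
      exact Finset.sum_congr rfl fun i _ => by ring
    obtain ⟨ihk, ihf, ihr⟩ := ih (fun i => sb L (G i)) (fun i => d i.succ)
      (fun i => sb_homog hL (hF _)) (fun i => hd _) hGz
    have hGk : KosP G := kos_lift hL (fun i => hF i.succ) ihk
    obtain ⟨M1, -, hM1⟩ := ell_part G (fun i => d i.succ) (fun i => hF _) L hL hGz ihk (ell L) (by simp)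
    rw [(quotEquiv L G).toLinearEquiv.finrank_eq, ihr] at hM1
    have hred := proj_ns F h0
    obtain ⟨M0, hM0⟩ := hred
    have hreg : ∀ q, q * F 0 ∈ I → q ∈ I := by
      intro q hq
      have h1 := hM0 M0 le_rfl (ell L ^ M0) (by simpa using (ell_homog hL).pow M0)
      rw [hspan] at h1
      obtain ⟨i, hi, z, hz, hiz⟩ := Submodule.mem_sup.1 h1
      obtain ⟨t, rfl⟩ := Ideal.mem_span_singleton'.1 hz
      have h2 : q * ell L ^ M0 ∈ I := by
        rw [← hiz, show q * (i + t * F 0) = q * i + t * (q * F 0) by ring]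
        exact add_mem (I.mul_mem_left _ hi) (I.mul_mem_left _ hq)
      have h3 : ∀ k, q * ell L ^ k ∈ I → q ∈ I := by
        intro k
        induction k with
        | zero => simp
        | succ k ih =>
          intro h
          apply ih
          apply ell_reg ihk
          rwa [mul_assoc, ← pow_succ]
      exact h3 _ h2
    obtain ⟨hf, hH⟩ := lemmaH I (span_hc fun i => hF i.succ) (F 0) (F 0) (d 0) (hF 0) (by simp) hreg M0
      (by
        rw [← hspan]
        exact reduce _ M0 fun k hk p hp => ⟨p, hM0 k hk p hp, by simp⟩)
    refine ⟨kos_cons F hGk hreg, ?_⟩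
    rw [hspan]
    refine ⟨hf, ?_⟩
    have e1 := hH (M0 + M1) (by omega)
    have e2 := HQ_mul (M := M0 + M1) (fun M' h => hM1 M' (by omega)) (d 0)
    rw [Fin.prod_univ_succ]
    rw [← hI] at e2
    omega

theorem affbez [IsAlgClosed K] {N : ℕ} (F : Fin N → MvPolynomial (Fin (N + 1)) K) (d : Fin N → ℕ)
    (hF : ∀ i, (F i).IsHomogeneous (d i)) (hd : ∀ i, 1 ≤ d i)
    (h0 : ∀ w : Fin N → K, (∀ i, eval (Fin.cons 0 w : Fin (N + 1) → K) (F i) = 0) → w = 0) :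
    Module.Finite K (MvPolynomial (Fin N) K ⧸ Ideal.span (Set.range fun i => sb 1 (F i))) ∧
      Module.finrank K (MvPolynomial (Fin N) K ⧸ Ideal.span (Set.range fun i => sb 1 (F i)))
        = ∏ i, d i := by
  have hL : (0 : MvPolynomial (Fin N) K).IsHomogeneous 1 := isHomogeneous_zero _ _ _
  have h0' : ∀ w : Fin N → K, (∀ i, eval w (sb 0 (F i)) = 0) → w = 0 := by
    intro w hw
    apply h0
    intro i
    have := hw i
    rwa [eval_sb, map_zero] at this
  obtain ⟨hk, hf, hr⟩ := bezout N (fun i => sb 0 (F i)) d (fun i => sb_homog hL (hF i)) hd h0'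
  obtain ⟨M1, -, hM1⟩ := ell_part F d hF 0 hL h0' hk (ell 0) (by simp)
  obtain ⟨M2, hf2, hM2⟩ := ell_part F d hF 0 hL h0' hk (ell 1) (by
    have : (ell 1 - ell 0 : MvPolynomial (Fin (N + 1)) K) = - 1 := by simp [ell]
    rw [this]
    exact neg_mem (mem_LT_of_homog (isHomogeneous_one _ _)))
  rw [(quotEquiv 0 F).toLinearEquiv.finrank_eq, hr] at hM1
  rw [(quotEquiv 1 F).toLinearEquiv.finrank_eq] at hM2
  refine ⟨Module.Finite.equiv (quotEquiv 1 F).toLinearEquiv, ?_⟩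
  have e1 := hM1 (M1 + M2) (by omega)
  have e2 := hM2 (M1 + M2) (by omega)
  omega

end B
end Bez
end

open MvPolynomial
noncomputable section
namespace Bez
section HZ
variable {K : Type*} [Field K] {σ : Type*} {A A' : Type*} [CommRing A] [Algebra K A]
  [CommRing A'] [Algebra K A']

/-- homogenization evaluated at a point of an algebra -/
def Hz (d : ℕ) (p : MvPolynomial σ K) (x : σ → A) (t : A) : A :=
  ∑ k ∈ Finset.range (d + 1), t ^ (d - k) * aeval x (homogeneousComponent k p)

lemma aeval_smul_homog {p : MvPolynomial σ K} {d : ℕ} (hp : p.IsHomogeneous d) (r : A) (x : σ → A) :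
    aeval (r • x) p = r ^ d * aeval x p := by
  rw [aeval_def, eval₂_eq, aeval_def, eval₂_eq, Finset.mul_sum]
  refine Finset.sum_congr rfl fun m hm => ?_
  have := hp.degree_eq_sum_deg_support hm
  simp only [Pi.smul_apply, smul_eq_mul, mul_pow]
  rw [Finset.prod_mul_distrib, Finset.prod_pow_eq_pow_sum, ← this]; ring

lemma Hz_smul (d : ℕ) (p : MvPolynomial σ K) (x : σ → A) (t r : A) :
    Hz d p (r • x) (r * t) = r ^ d * Hz d p x t := by
  rw [Hz, Hz, Finset.mul_sum]
  refine Finset.sum_congr rfl fun k hk => ?_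
  rw [aeval_smul_homog (homogeneousComponent_isHomogeneous k p)]
  have : d = (d - k) + k := by simp at hk; omega
  conv_rhs => rw [this]
  rw [Nat.add_sub_cancel, mul_pow, pow_add]
  ring

lemma Hz_one {d : ℕ} {p : MvPolynomial σ K} (hp : p ∈ LT σ K (d + 1)) (x : σ → A) :
    Hz d p x 1 = aeval x p := by
  conv_rhs => rw [eq_sum_of_mem_LT hp]
  simp [Hz]

lemma Hz_sum {ι : Type*} (s : Finset ι) (d : ℕ) (p : ι → MvPolynomial σ K) (x : σ → A) (t : A) :
    Hz d (∑ i ∈ s, p i) x t = ∑ i ∈ s, Hz d (p i) x t := by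
  simp only [Hz, map_sum, Finset.mul_sum]
  rw [Finset.sum_comm]

lemma Hz_map (φ : A →ₐ[K] A') (d : ℕ) (p : MvPolynomial σ K) (x : σ → A) (t : A) :
    φ (Hz d p x t) = Hz d p (φ ∘ x) (φ t) := by
  simp only [Hz, map_sum, map_mul, map_pow]
  refine Finset.sum_congr rfl fun k hk => ?_
  congr 1
  rw [← AlgHom.comp_apply, comp_aeval]; rfl

lemma Hz_zero (d : ℕ) (p : MvPolynomial σ K) (x : σ → A) :
    Hz d p x 0 = aeval x (homogeneousComponent d p) := by
  rw [Hz, Finset.sum_range_succ, Finset.sum_eq_zero]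
  · simp
  · intro k hk
    rw [zero_pow (by simp at hk; omega), zero_mul]

lemma Hz_add_deg {d : ℕ} {p : MvPolynomial σ K} (hp : p ∈ LT σ K (d + 1)) (e : ℕ) (x : σ → A) (t : A) :
    Hz (d + e) p x t = t ^ e * Hz d p x t := by
  rw [Hz, Hz, Finset.mul_sum]
  rw [← Finset.sum_subset (s₁ := Finset.range (d + 1)) (s₂ := Finset.range (d + e + 1))]
  · refine Finset.sum_congr rfl fun k hk => ?_
    rw [show d + e - k = e + (d - k) by simp at hk; omega, pow_add, mul_assoc]
  · intro i; simp; omega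
  · intro i _ hi
    rw [hp i (by simpa using hi)]; simp

lemma Hz_mul {a : MvPolynomial σ K} {k : ℕ} (ha : a.IsHomogeneous k) (d : ℕ) (p : MvPolynomial σ K)
    (x : σ → A) (t : A) : Hz (d + k) (a * p) x t = aeval x a * Hz d p x t := by
  rw [Hz, Hz, Finset.mul_sum, mul_comm a, show d + k + 1 = k + (d + 1) by ring, Finset.sum_range_add,
    Finset.sum_eq_zero, zero_add]
  · refine Finset.sum_congr rfl fun j hj => ?_
    rw [add_comm k j, hc_mul ha, map_mul, show d + k - (j + k) = d - j by omega]; ring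
  · intro j hj
    rw [hc_mul_lt ha _ (by simpa using hj)]; simp

lemma Hz_homog {τ : Type*} (d : ℕ) (p : MvPolynomial σ K) (x : σ → MvPolynomial τ K)
    (t : MvPolynomial τ K) (hx : ∀ i, (x i).IsHomogeneous 1) (ht : t.IsHomogeneous 1) :
    (Hz d p x t).IsHomogeneous d := by
  refine IsHomogeneous.sum _ _ _ fun k hk => ?_
  have h1 := (ht.pow (d - k)).mul ((homogeneousComponent_isHomogeneous k p).aeval x hx)
  rwa [show 1 * (d - k) + 1 * k = d by simp at hk; omega] at h1

lemma Hz_split {d e : ℕ} (he : 1 ≤ e) (hed : e ≤ d) {p : MvPolynomial σ K}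
    (hp : p - homogeneousComponent d p ∈ LT σ K (d - e + 1)) (x : σ → A) (t : A) :
    ∃ r, Hz d p x t = aeval x (homogeneousComponent d p) + t ^ e * r := by
  refine ⟨Hz (d - e) p x t, ?_⟩
  have h0 : ∀ k ∈ Finset.range d, d - e + 1 ≤ k → homogeneousComponent k p = 0 := by
    intro k hk hk'
    have := hp k hk'
    rw [map_sub, hc_hc, if_neg (by simp at hk; omega), sub_zero] at this
    exact this
  rw [Hz, Finset.sum_range_succ, Nat.sub_self, pow_zero, one_mul, add_comm, Hz, Finset.mul_sum]
  congr 1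
  rw [← Finset.sum_subset (s₁ := Finset.range (d - e + 1)) (s₂ := Finset.range d)]
  · refine Finset.sum_congr rfl fun k hk => ?_
    rw [show d - k = e + (d - e - k) by simp at hk; omega, pow_add, mul_assoc]
  · intro i; simp; omega
  · intro i hi hi'
    rw [h0 i hi (by simpa using hi')]; simp

lemma ns_top [IsAlgClosed K] [Finite σ] (J : Ideal (MvPolynomial σ K))
    (h : ∀ v : σ → K, ∃ p ∈ J, eval v p ≠ 0) : J = ⊤ := by
  rw [← Ideal.radical_eq_top, ← vanishingIdeal_zeroLocus_eq_radical (k := K) (K := K) J]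
  rw [Ideal.eq_top_iff_one, mem_vanishingIdeal_iff]
  intro x hx
  obtain ⟨p, hp, hp'⟩ := h x
  exact absurd (by simpa using hx p hp) hp'

lemma crt_finrank {R : Type*} [CommRing R] [Algebra K R] (J : Ideal R) [Module.Finite K (R ⧸ J)]
    (a b : R) (hab : a * b ∈ J) (htop : J ⊔ Ideal.span {a} ⊔ Ideal.span {b} = ⊤) :
    Module.finrank K (R ⧸ J) = Module.finrank K (R ⧸ (J ⊔ Ideal.span {a})) +
      Module.finrank K (R ⧸ (J ⊔ Ideal.span {b})) := by
  have hf1 : Module.Finite K (R ⧸ (J ⊔ Ideal.span {a})) :=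
    Module.Finite.of_surjective (Ideal.Quotient.factorₐ K (le_sup_left (a := J) (b := Ideal.span {a}))).toLinearMap
      (Ideal.Quotient.factor_surjective le_sup_left)
  have hf2 : Module.Finite K (R ⧸ (J ⊔ Ideal.span {b})) :=
    Module.Finite.of_surjective (Ideal.Quotient.factorₐ K (le_sup_left (a := J) (b := Ideal.span {b}))).toLinearMap
      (Ideal.Quotient.factor_surjective le_sup_left)
  have hcop : IsCoprime (J ⊔ Ideal.span {a}) (J ⊔ Ideal.span {b}) := by
    rw [Ideal.isCoprime_iff_sup_eq, eq_top_iff, ← htop]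
    exact sup_le le_sup_left (le_sup_right.trans le_sup_right)
  have hinf : (J ⊔ Ideal.span {a}) ⊓ (J ⊔ Ideal.span {b}) = J := by
    apply le_antisymm _ (le_inf le_sup_left le_sup_left)
    rw [← Ideal.mul_eq_inf_of_isCoprime hcop, Ideal.sup_mul, Ideal.mul_sup, Ideal.mul_sup]
    refine sup_le (sup_le ?_ ?_) (sup_le ?_ ?_) <;> try first | exact Ideal.mul_le_left | exact Ideal.mul_le_right
    rw [Ideal.span_singleton_mul_span_singleton, Ideal.span_singleton_le_iff_mem]
    exact hab
  let e0 := Ideal.quotientInfEquivQuotientProd _ _ hcop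
  let e : (R ⧸ ((J ⊔ Ideal.span {a}) ⊓ (J ⊔ Ideal.span {b}))) ≃ₐ[K] _ :=
    AlgEquiv.ofRingEquiv (f := e0) (fun r => rfl)
  have h1 := e.toLinearEquiv.finrank_eq
  rw [hinf] at h1
  rw [h1, Module.finrank_prod]

end HZ
end Bez
end

open MvPolynomial
noncomputable section
namespace Bez
section Main
variable {K : Type*} [Field K] {m : ℕ}

/-- append a last coordinate -/
def sn {A : Type*} (y : Fin m → A) (t : A) : Fin (m + 1) → A := Fin.snoc (α := fun _ => A) y t

@[simp] lemma sn_last {A : Type*} (y : Fin m → A) (t : A) : sn y t (Fin.last m) = t := by simp [sn]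
@[simp] lemma sn_cast {A : Type*} (y : Fin m → A) (t : A) (i : Fin m) : sn y t i.castSucc = y i := by
  simp [sn]
lemma comp_sn {A A' : Type*} (φ : A → A') (y : Fin m → A) (t : A) :
    φ ∘ sn y t = sn (φ ∘ y) (φ t) := by
  ext i
  refine Fin.lastCases ?_ (fun i => ?_) i <;> simp
lemma smul_sn {A : Type*} [CommRing A] (r : A) (y : Fin m → A) (t : A) :
    r • sn y t = sn (r • y) (r * t) := by
  ext i
  refine Fin.lastCases ?_ (fun i => ?_) i <;> simp

/-- dehomogenization -/
def dh : MvPolynomial (Fin (m + 1)) K →ₐ[K] MvPolynomial (Fin m) K := aeval (sn X 1)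

variable (m) in
/-- `y` -/
def yv : Fin m → MvPolynomial (Fin (m + 1)) K := fun i => X i.castSucc
variable (m) in
/-- `t` -/
def tv : MvPolynomial (Fin (m + 1)) K := X (Fin.last m)

/-- `xx` -/
def xx (c : K) : Fin (m + 1) → MvPolynomial (Fin (m + 1)) K := sn (yv m) (1 - C c * tv m)

/-- auxiliary equivalence, away from `t = 0` -/
lemma away_equiv {f : Fin (m + 1) → MvPolynomial (Fin (m + 1)) K} {D : ℕ}
    (hf : ∀ i, f i ∈ LT _ K (D + 1)) {u : MvPolynomial (Fin (m + 1)) K} {du : ℕ}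
    (hu : u ∈ LT _ K (du + 1)) (huf : u ∈ Ideal.span (Set.range f)) (c : K)
    (hl : IsUnit (Ideal.Quotient.mk (Ideal.span (Set.range f)) (X (Fin.last m) + C c)))
    (J : Ideal (MvPolynomial (Fin (m + 1)) K))
    (hJ : J = Ideal.span (Set.range fun i => Hz D (f i) (xx c) (tv m)) ⊔
      Ideal.span {Hz du u (xx c) (tv m)})
    (ht : IsUnit (Ideal.Quotient.mk J (tv m))) :
    Nonempty ((MvPolynomial (Fin (m + 1)) K ⧸ J) ≃ₐ[K]
      (MvPolynomial (Fin (m + 1)) K ⧸ Ideal.span (Set.range f))) := by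
  set I := Ideal.span (Set.range f) with hI
  obtain ⟨l, hl'⟩ := hl.exists_left_inv
  obtain ⟨τ, hτ⟩ := ht.exists_left_inv
  let qI := Ideal.Quotient.mkₐ K I
  let qJ := Ideal.Quotient.mkₐ K J
  have hl2 : l * (qI (X (Fin.last m)) + algebraMap K _ c) = 1 := hl'
  have hτ2 : τ * qJ (tv m) = 1 := hτ
  let x : Fin (m + 1) → (MvPolynomial (Fin (m + 1)) K ⧸ I) := fun i => qI (X i)
  let φ0 : MvPolynomial (Fin (m + 1)) K →ₐ[K] (MvPolynomial (Fin (m + 1)) K ⧸ I) :=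
    aeval (sn (fun i => l * x i.castSucc) l)
  have hφt : φ0 (tv m) = l := by simp [φ0, tv]
  have hφx : φ0 ∘ xx c = l • x := by
    rw [xx, comp_sn, map_sub, map_mul, hφt]
    ext i
    refine Fin.lastCases ?_ (fun i => ?_) i
    · simp only [sn_last, Pi.smul_apply, smul_eq_mul, map_one, algHom_C]
      have : l * x (Fin.last m) + l * algebraMap K _ c = 1 := by rw [← mul_add]; exact hl2
      rw [← this]; ring
    · simp [φ0, yv]
  have hx : ∀ p, aeval x p = qI p := by
    intro p
    have : qI = aeval x := by
      apply algHom_ext; intro i; simp [x]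
    rw [this]
  have hφ : ∀ p d, p ∈ LT _ K (d + 1) → p ∈ I → φ0 (Hz d p (xx c) (tv m)) = 0 := by
    intro p d hp hpI
    have h1 := Hz_smul d p x 1 l
    rw [mul_one, Hz_one hp, hx] at h1
    rw [Hz_map, hφx, hφt, h1]
    rw [show qI p = 0 from Ideal.Quotient.eq_zero_iff_mem.2 hpI, mul_zero]
  let ψ0 : MvPolynomial (Fin (m + 1)) K →ₐ[K] (MvPolynomial (Fin (m + 1)) K ⧸ J) :=
    aeval (τ • (qJ ∘ xx c))
  have hψ : ∀ i, ψ0 (f i) = 0 := by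
    intro i
    have h1 := Hz_smul D (f i) (qJ ∘ xx c) (qJ (tv m)) τ
    rw [hτ2, Hz_one (hf i), ← Hz_map] at h1
    change aeval _ (f i) = 0
    rw [h1]
    have : qJ (Hz D (f i) (xx c) (tv m)) = 0 := Ideal.Quotient.eq_zero_iff_mem.2 (by
      rw [hJ]; exact Ideal.mem_sup_left (Ideal.subset_span ⟨i, rfl⟩))
    rw [this, mul_zero]
  let φ : (MvPolynomial (Fin (m + 1)) K ⧸ J) →ₐ[K] (MvPolynomial (Fin (m + 1)) K ⧸ I) :=
    Ideal.Quotient.liftₐ J φ0 (by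
      have : J ≤ RingHom.ker φ0 := by
        rw [hJ, sup_le_iff, Ideal.span_le, Ideal.span_singleton_le_iff_mem]
        constructor
        · rintro _ ⟨i, rfl⟩
          exact hφ _ _ (hf i) (Ideal.subset_span ⟨i, rfl⟩)
        · exact hφ _ _ hu huf
      exact fun a ha => this ha)
  let ψ : (MvPolynomial (Fin (m + 1)) K ⧸ I) →ₐ[K] (MvPolynomial (Fin (m + 1)) K ⧸ J) :=
    Ideal.Quotient.liftₐ I ψ0 (by
      have : I ≤ RingHom.ker ψ0 := by
        rw [hI, Ideal.span_le]
        rintro _ ⟨i, rfl⟩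
        exact hψ i
      exact fun a ha => this ha)
  have hφq : ∀ p, φ (qJ p) = φ0 p := fun p => rfl
  have hψq : ∀ p, ψ (qI p) = ψ0 p := fun p => rfl
  have hφτ : φ τ * l = 1 := by
    rw [← hφt, ← hφq, ← map_mul, hτ2, map_one]
  have hψx : ∀ i, ψ (x i) = τ * qJ (xx c i) := by
    intro i
    simp only [x]
    rw [hψq]
    simp [ψ0]
  have hψl : ψ l = qJ (tv m) := by
    have h1 := congrArg ψ hl2
    rw [map_mul, map_add, AlgHom.commutes, map_one] at h1
    have h2 : ψ (qI (X (Fin.last m))) = τ - algebraMap K _ c := by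
      rw [show qI (X (Fin.last m)) = x (Fin.last m) from rfl, hψx, xx, sn_last, map_sub, map_mul, map_one]
      have : qJ (C c) = algebraMap K _ c := by simp
      rw [this]
      calc _ = τ - algebraMap K _ c * (τ * qJ (tv m)) := by ring
        _ = _ := by rw [hτ2, mul_one]
    rw [h2, sub_add_cancel] at h1
    calc ψ l = ψ l * (τ * qJ (tv m)) := by rw [hτ2, mul_one]
      _ = (ψ l * τ) * qJ (tv m) := by ring
      _ = _ := by rw [h1, one_mul]
  refine ⟨AlgEquiv.ofAlgHom φ ψ ?_ ?_⟩
  · apply Ideal.Quotient.algHom_ext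
    apply algHom_ext
    intro i
    change φ (ψ (x i)) = x i
    rw [hψx, map_mul, hφq]
    have := congrFun hφx i
    simp only [Function.comp_apply, Pi.smul_apply, smul_eq_mul] at this
    rw [this, ← mul_assoc, hφτ, one_mul]
  · apply Ideal.Quotient.algHom_ext
    apply algHom_ext
    intro i
    change ψ (φ0 (X i)) = qJ (X i)
    refine Fin.lastCases ?_ (fun i => ?_) i
    · simp only [φ0, aeval_X, sn_last]; rw [hψl]; rfl
    · simp only [φ0, aeval_X, sn_cast]
      rw [map_mul, hψl, hψx, xx, sn_cast, yv]
      calc _ = (τ * qJ (tv m)) * qJ (X i.castSucc) := by ring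
        _ = _ := by rw [hτ2, one_mul]

/-- truncated polynomial ring -/
abbrev Qt (K : Type*) [Field K] (e : ℕ) := AdjoinRoot (Polynomial.X ^ e : Polynomial K)
/-- tensor product -/
abbrev Wt {K : Type*} [Field K] {m : ℕ} (J' : Ideal (MvPolynomial (Fin m) K)) (e : ℕ) :=
  TensorProduct K (MvPolynomial (Fin m) K ⧸ J') (Qt K e)

/-- near `t = 0` -/
lemma near_equiv_aux {f : Fin (m + 1) → MvPolynomial (Fin (m + 1)) K} {D e : ℕ} (he : 1 ≤ e) (heD : e ≤ D)
    (hf : ∀ i, f i - homogeneousComponent D (f i) ∈ LT _ K (D - e + 1)) (c : K)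
    (J : Ideal (MvPolynomial (Fin (m + 1)) K))
    (hJ : J = Ideal.span (Set.range fun i => Hz D (f i) (xx c) (tv m)) ⊔
      Ideal.span {tv m ^ e}) (J' : Ideal (MvPolynomial (Fin m) K))
    (hJ' : J' = Ideal.span (Set.range fun i => dh (homogeneousComponent D (f i))))
    {W : Type*} [CommRing W] [Algebra K W] (iL : (MvPolynomial (Fin m) K ⧸ J') →ₐ[K] W)
    (iR : Qt K e →ₐ[K] W)
    (hlift : ∀ (ψL : (MvPolynomial (Fin m) K ⧸ J') →ₐ[K] (MvPolynomial (Fin (m + 1)) K ⧸ J))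
      (ψR : Qt K e →ₐ[K] (MvPolynomial (Fin (m + 1)) K ⧸ J)),
      ∃ ψ : W →ₐ[K] (MvPolynomial (Fin (m + 1)) K ⧸ J), (∀ a, ψ (iL a) = ψL a) ∧ ∀ a, ψ (iR a) = ψR a)
    (hext : ∀ α β : W →ₐ[K] W, α.comp iL = β.comp iL → α.comp iR = β.comp iR → α = β) :
    Nonempty ((MvPolynomial (Fin (m + 1)) K ⧸ J) ≃ₐ[K] W) := by
  let qJ := Ideal.Quotient.mkₐ K J
  let q' := Ideal.Quotient.mkₐ K J'
  let g := fun i => homogeneousComponent D (f i)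
  have hg : ∀ i, (g i).IsHomogeneous D := fun i => homogeneousComponent_isHomogeneous _ _
  let TT : (Qt K e) := AdjoinRoot.root _
  have hTT : TT ^ e = 0 := by
    have := AdjoinRoot.eval₂_root (Polynomial.X ^ e : Polynomial K)
    simpa using this
  let S : W := 1 - algebraMap K W c * iR TT
  let φ0 : MvPolynomial (Fin (m + 1)) K →ₐ[K] W :=
    aeval (sn (fun i => S * iL (q' (X i))) (iR TT))
  have hφt : φ0 (tv m) = iR TT := by simp [φ0, tv]
  have hφx : φ0 ∘ xx c = S • (sn (fun i => iL (q' (X i))) 1) := by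
    rw [xx, comp_sn, smul_sn, map_sub, map_mul, hφt, mul_one]
    congr 1
    · ext i; simp [φ0, yv]
    · simp [S]
  have hg' : ∀ i, aeval (sn (fun i => iL (q' (X i))) 1 : Fin (m + 1) → W) (g i) = iL (q' (dh (g i))) := by
    intro i
    have : (iL.comp (q'.comp dh)) = aeval (sn (fun i => iL (q' (X i))) 1 : Fin (m + 1) → W) := by
      apply algHom_ext
      intro i
      refine Fin.lastCases ?_ (fun i => ?_) i
      · simp [dh]
      · simp [dh]
    rw [← this]; rfl
  have hg0 : ∀ i, q' (dh (g i)) = 0 := fun i => Ideal.Quotient.eq_zero_iff_mem.2 (by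
    rw [hJ']; exact Ideal.subset_span ⟨i, rfl⟩)
  have hφJ : J ≤ RingHom.ker φ0 := by
    rw [hJ, sup_le_iff, Ideal.span_le, Ideal.span_singleton_le_iff_mem]
    constructor
    · rintro _ ⟨i, rfl⟩
      change φ0 _ = 0
      simp only
      rw [Hz_map]
      obtain ⟨r, hr⟩ := Hz_split he heD (hf i) (φ0 ∘ xx c) (φ0 (tv m))
      rw [hr, hφx, aeval_smul_homog (hg i), hg', hg0, map_zero, mul_zero, hφt, ← map_pow, hTT]
      simp
    · change φ0 _ = 0
      rw [map_pow, hφt, ← map_pow, hTT, map_zero]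
  have hte : qJ (tv m) ^ e = 0 := by
    rw [← map_pow]
    exact Ideal.Quotient.eq_zero_iff_mem.2 (by
      rw [hJ]; exact Ideal.mem_sup_right (Ideal.mem_span_singleton_self _))
  let s := qJ (1 - C c * tv m)
  have hs : IsUnit s := by
    simp only [s]
    rw [map_sub, map_one, map_mul]
    exact IsNilpotent.isUnit_one_sub ((Commute.all _ _).isNilpotent_mul_left ⟨e, hte⟩)
  obtain ⟨w, hw⟩ := hs.exists_left_inv
  let ψ1 : MvPolynomial (Fin m) K →ₐ[K] (MvPolynomial (Fin (m + 1)) K ⧸ J) :=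
    aeval (fun i => w * qJ (X i.castSucc))
  have hψ1 : ∀ p, ψ1 (dh p) = aeval (w • (qJ ∘ xx c)) p := by
    intro p
    have : ψ1.comp dh = aeval (w • (qJ ∘ xx c)) := by
      apply algHom_ext
      intro i
      refine Fin.lastCases ?_ (fun i => ?_) i
      · simp [dh, ψ1, xx, s] at hw ⊢
        exact hw.symm
      · simp [dh, ψ1, xx, yv]
    rw [← this]; rfl
  have hψJ : J' ≤ RingHom.ker ψ1 := by
    rw [hJ', Ideal.span_le]
    rintro _ ⟨i, rfl⟩
    change ψ1 (dh (g i)) = 0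
    rw [hψ1, aeval_smul_homog (hg i)]
    obtain ⟨r, hr⟩ := Hz_split he heD (hf i) (qJ ∘ xx c) (qJ (tv m))
    rw [hte, zero_mul, add_zero, ← Hz_map] at hr
    change w ^ D * aeval _ (homogeneousComponent D (f i)) = 0
    rw [← hr]
    have : qJ (Hz D (f i) (xx c) (tv m)) = 0 := Ideal.Quotient.eq_zero_iff_mem.2 (by
      rw [hJ]; exact Ideal.mem_sup_left (Ideal.subset_span ⟨i, rfl⟩))
    rw [this, mul_zero]
  let φ : (MvPolynomial (Fin (m + 1)) K ⧸ J) →ₐ[K] W :=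
    Ideal.Quotient.liftₐ J φ0 (fun a ha => hφJ ha)
  let ψL : (MvPolynomial (Fin m) K ⧸ J') →ₐ[K] (MvPolynomial (Fin (m + 1)) K ⧸ J) :=
    Ideal.Quotient.liftₐ J' ψ1 (fun a ha => hψJ ha)
  let ψR : (Qt K e) →ₐ[K] (MvPolynomial (Fin (m + 1)) K ⧸ J) :=
    AdjoinRoot.liftAlgHom _ (Algebra.ofId K _) (qJ (tv m)) (by simp [hte])
  have hψR : ψR TT = qJ (tv m) := by simp [ψR, TT]
  obtain ⟨ψ, hψiL, hψiR⟩ := hlift ψL ψR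
  have hφs : φ s = S := by
    change φ0 _ = S
    rw [map_sub, map_mul, hφt]; simp [S]
  have hφw : φ w * S = 1 := by
    rw [← hφs, ← map_mul, hw, map_one]
  have hψS : ψ S = s := by
    simp only [S, s]
    rw [map_sub ψ, map_mul ψ, map_one, AlgHom.commutes, hψiR, hψR, map_sub, map_mul, map_one]
    simp
  refine ⟨AlgEquiv.ofAlgHom φ ψ ?_ ?_⟩
  · apply hext
    · apply Ideal.Quotient.algHom_ext
      apply algHom_ext
      intro i
      change φ (ψ (iL (q' (X i)))) = iL (q' (X i))
      rw [hψiL]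
      change φ (ψ1 (X i)) = _
      simp only [ψ1, aeval_X]
      rw [map_mul]
      change φ w * φ0 (X i.castSucc) = _
      simp only [φ0, aeval_X, sn_cast]
      rw [← mul_assoc, hφw, one_mul]
    · apply AdjoinRoot.algHom_ext
      change φ (ψ (iR TT)) = iR TT
      rw [hψiR, hψR]
      exact hφt
  · apply Ideal.Quotient.algHom_ext
    apply algHom_ext
    intro i
    change ψ (φ0 (X i)) = qJ (X i)
    refine Fin.lastCases ?_ (fun i => ?_) i
    · simp only [φ0, aeval_X, sn_last]; rw [hψiR, hψR]; rfl
    · simp only [φ0, aeval_X, sn_cast]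
      rw [map_mul, hψS, hψiL]
      change s * ψ1 (X i) = _
      simp only [ψ1, aeval_X]
      rw [← mul_assoc, mul_comm s, hw, one_mul]

/-- near `t = 0` -/
lemma near_equiv {f : Fin (m + 1) → MvPolynomial (Fin (m + 1)) K} {D e : ℕ} (he : 1 ≤ e) (heD : e ≤ D)
    (hf : ∀ i, f i - homogeneousComponent D (f i) ∈ LT _ K (D - e + 1)) (c : K)
    (J : Ideal (MvPolynomial (Fin (m + 1)) K))
    (hJ : J = Ideal.span (Set.range fun i => Hz D (f i) (xx c) (tv m)) ⊔
      Ideal.span {tv m ^ e}) (J' : Ideal (MvPolynomial (Fin m) K))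
    (hJ' : J' = Ideal.span (Set.range fun i => dh (homogeneousComponent D (f i)))) :
    Nonempty ((MvPolynomial (Fin (m + 1)) K ⧸ J) ≃ₐ[K] Wt J' e) :=
  near_equiv_aux he heD hf c J hJ J' hJ' (W := Wt J' e) Algebra.TensorProduct.includeLeft
    Algebra.TensorProduct.includeRight
    (fun ψL ψR => ⟨Algebra.TensorProduct.productMap ψL ψR, by simp, by simp⟩)
    (fun α β h1 h2 => Algebra.TensorProduct.ext h1 h2)

lemma near_finrank {f : Fin (m + 1) → MvPolynomial (Fin (m + 1)) K} {D e : ℕ} (he : 1 ≤ e) (heD : e ≤ D)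
    (hf : ∀ i, f i - homogeneousComponent D (f i) ∈ LT _ K (D - e + 1)) (c : K)
    (J : Ideal (MvPolynomial (Fin (m + 1)) K))
    (hJ : J = Ideal.span (Set.range fun i => Hz D (f i) (xx c) (tv m)) ⊔
      Ideal.span {tv m ^ e}) (J' : Ideal (MvPolynomial (Fin m) K))
    (hJ' : J' = Ideal.span (Set.range fun i => dh (homogeneousComponent D (f i)))) :
    Module.finrank K (MvPolynomial (Fin (m + 1)) K ⧸ J) =
      e * Module.finrank K (MvPolynomial (Fin m) K ⧸ J') := by
  obtain ⟨E⟩ := near_equiv he heD hf c J hJ J' hJ'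
  rw [E.toLinearEquiv.finrank_eq]
  have h1 : Module.finrank K (Qt K e) = e := by
    rw [(AdjoinRoot.powerBasis (f := (Polynomial.X ^ e : Polynomial K)) (by simp)).finrank]
    simp
  have h2 := Module.finrank_tensorProduct (R := K) (S := K) (M := MvPolynomial (Fin m) K ⧸ J')
    (M' := Qt K e)
  rw [h1] at h2
  rw [mul_comm]
  exact h2

end Main
end Bez
end

open MvPolynomial
noncomputable section
namespace Bez
section Count
variable {K : Type*} [Field K] {m : ℕ}

lemma isUnit_of_sup {R : Type*} [CommRing R] (J : Ideal R) (a : R) (h : J ⊔ Ideal.span {a} = ⊤) :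
    IsUnit (Ideal.Quotient.mk J a) := by
  have h1 : (1 : R) ∈ J ⊔ Ideal.span {a} := by rw [h]; trivial
  obtain ⟨j, hj, b, hb, hjb⟩ := Submodule.mem_sup.1 h1
  obtain ⟨r, rfl⟩ := Ideal.mem_span_singleton'.1 hb
  refine IsUnit.of_mul_eq_one (Ideal.Quotient.mk J r) ?_
  rw [← map_mul, ← map_one (Ideal.Quotient.mk J), ← hjb, mul_comm, Ideal.Quotient.eq]
  simpa using hj

lemma eval_Hz {σ τ : Type*} (d : ℕ) (p : MvPolynomial σ K) (x : σ → MvPolynomial τ K)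
    (t : MvPolynomial τ K) (v : τ → K) :
    eval v (Hz d p x t) = Hz d p (fun i => eval v (x i)) (eval v t) := by
  have := Hz_map (aeval v) d p x t
  simpa [Function.comp_def, aeval_eq_eval] using this

lemma sn_eq (v : Fin (m + 1) → K) : sn (fun i => v i.castSucc) (v (Fin.last m)) = v := by
  ext i
  refine Fin.lastCases ?_ (fun i => ?_) i <;> simp

theorem count [IsAlgClosed K] (f : Fin (m + 1) → MvPolynomial (Fin (m + 1)) K) {D e k : ℕ} (he : 1 ≤ e) (heD : e ≤ D)
    (hfD : ∀ i, f i ∈ LT _ K (D + 1))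
    (hf : ∀ i, f i - homogeneousComponent D (f i) ∈ LT _ K (D - e + 1))
    (a : Fin (m + 1) → MvPolynomial (Fin (m + 1)) K) (ha : ∀ i, (a i).IsHomogeneous k)
    (u : MvPolynomial (Fin (m + 1)) K) (hu : u = ∑ i, a i * f i)
    (huL : u ∈ LT _ K (k + (D - e) + 1))
    (hz : ∀ x : Fin (m + 1) → K, x ≠ 0 → (∀ i, eval x (homogeneousComponent D (f i)) = 0) →
      x (Fin.last m) ≠ 0 ∧ eval x (homogeneousComponent (k + (D - e)) u) ≠ 0) :
    Module.Finite K (MvPolynomial (Fin (m + 1)) K ⧸ Ideal.span (Set.range f)) ∧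
    Module.Finite K (MvPolynomial (Fin m) K ⧸
      Ideal.span (Set.range fun i => dh (homogeneousComponent D (f i)))) ∧
    Module.finrank K (MvPolynomial (Fin (m + 1)) K ⧸ Ideal.span (Set.range f)) +
      e * Module.finrank K (MvPolynomial (Fin m) K ⧸
      Ideal.span (Set.range fun i => dh (homogeneousComponent D (f i)))) = D ^ (m + 1) := by
  set I := Ideal.span (Set.range f) with hI
  have huI : u ∈ I := by
    rw [hu]
    exact Ideal.sum_mem _ fun i _ => Ideal.mul_mem_left _ _ (Ideal.subset_span ⟨i, rfl⟩)
  -- finiteness of A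
  have hA : Module.Finite K (MvPolynomial (Fin (m + 1)) K ⧸ I) := by
    let P : Option (Fin (m + 1)) → MvPolynomial (Fin (m + 1)) K := fun o => o.elim u f
    let T : Option (Fin (m + 1)) → MvPolynomial (Fin (m + 1)) K :=
      fun o => o.elim (homogeneousComponent (k + (D - e)) u) (fun i => homogeneousComponent D (f i))
    let d : Option (Fin (m + 1)) → ℕ := fun o => o.elim (k + (D - e)) (fun _ => D)
    obtain ⟨M, hM⟩ := reduce_top P T d
      (by rintro (_ | i) <;> exact homogeneousComponent_isHomogeneous _ _)
      (by
        rintro (_ | i)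
        · exact sub_hc_mem_LT huL
        · exact sub_hc_mem_LT (hfD i))
      (by
        intro v hv
        by_contra hv0
        exact (hz v hv0 (fun i => hv (some i))).2 (hv none))
    refine finite_of_reduce I M fun p => ?_
    obtain ⟨r, hr, hpr⟩ := hM p
    refine ⟨r, hr, ?_⟩
    have : Ideal.span (Set.range P) ≤ I := by
      rw [Ideal.span_le]
      rintro _ ⟨(_ | i), rfl⟩
      · exact huI
      · exact Ideal.subset_span ⟨i, rfl⟩
    exact this hpr
  have hZ := finite_zeros I
  -- choose c
  obtain ⟨c, hc⟩ : ∃ c : K, ∀ v : Fin (m + 1) → K, (∀ i, eval v (f i) = 0) → v (Fin.last m) + c ≠ 0 := by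
    have hfin : (((fun v : Fin (m + 1) → K => - v (Fin.last m)) '' {v | ∀ p ∈ I, eval v p = 0})).Finite :=
      hZ.image _
    obtain ⟨c, hc⟩ := hfin.infinite_compl.nonempty
    refine ⟨c, fun v hv h => hc ⟨v, ?_, by simp only; linear_combination -h⟩⟩
    intro p hp
    have : I ≤ RingHom.ker (eval v) := by
      rw [hI, Ideal.span_le]
      rintro _ ⟨i, rfl⟩
      exact hv i
    exact this hp
  have hl : IsUnit (Ideal.Quotient.mk I (X (Fin.last m) + C c)) := by
    apply isUnit_of_sup
    apply ns_top
    intro v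
    by_cases h : ∀ i, eval v (f i) = 0
    · exact ⟨_, Ideal.mem_sup_right (Ideal.mem_span_singleton_self _), by simpa using hc v h⟩
    · push Not at h
      obtain ⟨i, hi⟩ := h
      exact ⟨_, Ideal.mem_sup_left (Ideal.subset_span ⟨i, rfl⟩), hi⟩
  -- the homogenized system
  let G : Fin (m + 1) → MvPolynomial (Fin (m + 1)) K := fun i => Hz D (f i) (xx c) (tv m)
  let xF : Fin (m + 1) → MvPolynomial (Fin (m + 1 + 1)) K :=
    sn (fun i => X i.castSucc.succ) (X 0 - C c * X (Fin.last m).succ)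
  let F : Fin (m + 1) → MvPolynomial (Fin (m + 1 + 1)) K := fun i => Hz D (f i) xF (X (Fin.last m).succ)
  have hFG : ∀ i, sb 1 (F i) = G i := by
    intro i
    simp only [F, G]
    rw [Hz_map]
    congr 1
    · ext1 i
      refine Fin.lastCases ?_ (fun i => ?_) i
      · simp [xF, xx, tv, sb, algHom_C]
      · simp [xF, xx, yv, sb]
    · simp [tv, sb]
  have haff := affbez F (fun _ => D) (fun i => by
      apply Hz_homog
      · intro i
        refine Fin.lastCases ?_ (fun i => ?_) i
        · simp only [xF, sn_last]
          refine (isHomogeneous_X _ _).sub ?_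
          have := (isHomogeneous_C (Fin (m + 1 + 1)) c).mul (isHomogeneous_X K (Fin.last m).succ)
          simpa using this
        · simp only [xF, sn_cast]; exact isHomogeneous_X _ _
      · exact isHomogeneous_X _ _) (fun _ => he.trans heD) (by
      intro w hw
      have hw' : ∀ i, Hz D (f i) (sn (fun i => w i.castSucc) (- c * w (Fin.last m)) : Fin (m+1) → K) (w (Fin.last m)) = 0 := by
        intro i
        rw [← hw i]
        simp only [F]
        rw [eval_Hz]
        congr 1
        · ext i
          refine Fin.lastCases ?_ (fun i => ?_) i
          · simp [xF]
          · simp [xF]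
        · simp
      by_cases h : w (Fin.last m) = 0
      · by_contra hw0
        have h1 : ∀ i, eval w (homogeneousComponent D (f i)) = 0 := by
          intro i
          have := hw' i
          rw [h, Hz_zero, mul_zero] at this
          have h2 := sn_eq w
          rw [h] at h2
          rwa [h2, aeval_eq_eval] at this
        exact (hz w hw0 h1).1 h
      · exfalso
        refine hc ((w (Fin.last m))⁻¹ • (sn (fun i => w i.castSucc) (- c * w (Fin.last m)))) ?_ ?_
        · intro i
          rw [← aeval_eq_eval, ← Hz_one (hfD i), ← inv_mul_cancel₀ h, Hz_smul, hw' i, mul_zero]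
        · simp [mul_comm, h])
  have hspan : (fun i => sb 1 (F i)) = G := funext hFG
  rw [hspan] at haff
  obtain ⟨hGfin, hGrank⟩ := haff
  -- J' finite
  set J' := Ideal.span (Set.range fun i => dh (homogeneousComponent D (f i))) with hJ'
  have hJ'fin : Module.Finite K (MvPolynomial (Fin m) K ⧸ J') := by
    let q' := Ideal.Quotient.mkₐ K J'
    let θ0 : MvPolynomial (Fin (m + 1)) K →ₐ[K] (MvPolynomial (Fin m) K ⧸ J') := q'.comp (aeval (sn X 0))
    let θ : (MvPolynomial (Fin (m + 1)) K ⧸ Ideal.span (Set.range G)) →ₐ[K] (MvPolynomial (Fin m) K ⧸ J') :=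
      Ideal.Quotient.liftₐ _ θ0 (by
        have : Ideal.span (Set.range G) ≤ RingHom.ker θ0 := by
          rw [Ideal.span_le]
          rintro _ ⟨i, rfl⟩
          change q' (aeval (sn X 0) (Hz D (f i) (xx c) (tv m))) = 0
          rw [Hz_map]
          have h1 : (aeval (sn X 0) : MvPolynomial (Fin (m + 1)) K →ₐ[K] MvPolynomial (Fin m) K) (tv m) = 0 := by simp [tv]
          rw [h1, Hz_zero]
          refine Ideal.Quotient.eq_zero_iff_mem.2 (Ideal.subset_span ⟨i, ?_⟩)
          simp only [dh]
          congr 2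
          rw [xx, comp_sn]
          congr 1
          · ext1 i; simp [yv]
          · simp [tv]
        exact fun a ha => this ha)
    refine Module.Finite.of_surjective θ.toLinearMap ?_
    intro x
    obtain ⟨p, rfl⟩ := Ideal.Quotient.mk_surjective x
    refine ⟨Ideal.Quotient.mk _ (aeval (fun i : Fin m => (X i.castSucc : MvPolynomial (Fin (m + 1)) K)) p), ?_⟩
    change q' (aeval (sn X 0) (aeval (fun i : Fin m => (X i.castSucc : MvPolynomial (Fin (m + 1)) K)) p)) = q' p
    congr 1
    have : (aeval (sn X 0) : MvPolynomial (Fin (m + 1)) K →ₐ[K] MvPolynomial (Fin m) K).comp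
      (aeval (fun i : Fin m => (X i.castSucc : MvPolynomial (Fin (m + 1)) K))) = AlgHom.id _ _ := by
      apply algHom_ext; intro i; simp
    exact congrArg (fun φ : MvPolynomial (Fin m) K →ₐ[K] MvPolynomial (Fin m) K => φ p) this
  refine ⟨hA, hJ'fin, ?_⟩
  let uB := Hz (k + (D - e)) u (xx c) (tv m)
  have htu : tv m ^ e * uB ∈ Ideal.span (Set.range G) := by
    simp only [uB]
    rw [← Hz_add_deg huL, show k + (D - e) + e = D + k by omega, hu, Hz_sum]
    refine Ideal.sum_mem _ fun i _ => ?_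
    rw [Hz_mul (ha i)]
    exact Ideal.mul_mem_left _ _ (Ideal.subset_span ⟨i, rfl⟩)
  have htop : Ideal.span (Set.range G) ⊔ Ideal.span {tv m ^ e} ⊔ Ideal.span {uB} = ⊤ := by
    apply ns_top
    intro v
    by_contra! h
    have h1 : ∀ i, eval v (G i) = 0 := fun i =>
      h _ (Ideal.mem_sup_left (Ideal.mem_sup_left (Ideal.subset_span ⟨i, rfl⟩)))
    have h2 : eval v (tv m ^ e) = 0 :=
      h _ (Ideal.mem_sup_left (Ideal.mem_sup_right (Ideal.mem_span_singleton_self _)))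
    have h3 : eval v uB = 0 := h _ (Ideal.mem_sup_right (Ideal.mem_span_singleton_self _))
    have h4 : eval v (tv m : MvPolynomial (Fin (m + 1)) K) = 0 := by
      rw [map_pow] at h2; exact pow_eq_zero_iff (by omega) |>.1 h2
    simp only [G] at h1
    simp only [uB] at h3
    simp only [eval_Hz, h4, Hz_zero, aeval_eq_eval] at h1 h3
    refine (hz _ ?_ h1).2 h3
    intro h5
    have := congrFun h5 (Fin.last m)
    simp [xx, h4] at this
  have hcrt := crt_finrank (K := K) _ _ _ htu htop
  have hunit : IsUnit (Ideal.Quotient.mk (Ideal.span (Set.range G) ⊔ Ideal.span {uB}) (tv m)) := by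
    rw [← isUnit_pow_iff (n := e) (by omega), ← map_pow]
    apply isUnit_of_sup
    rw [← htop, sup_right_comm]
  obtain ⟨E⟩ := away_equiv hfD huL huI c hl _ rfl hunit
  rw [hGrank, near_finrank he heD hf c _ rfl J' hJ', E.toLinearEquiv.finrank_eq] at hcrt
  rw [Finset.prod_const, Finset.card_univ, Fintype.card_fin] at hcrt
  rw [hcrt, add_comm]

end Count
end Bez
end

open MvPolynomial
noncomputable section
namespace Bez
section CountF
variable {K : Type*} [Field K] {m : ℕ}

lemma hc_pderiv {σ : Type*} (i : σ) (p : MvPolynomial σ K) (j : ℕ) :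
    homogeneousComponent j (pderiv i p) = pderiv i (homogeneousComponent (j + 1) p) := by
  classical
  have key : ∀ (k : ℕ) (q : MvPolynomial σ K), q.IsHomogeneous k →
      homogeneousComponent j (pderiv i q) = pderiv i (homogeneousComponent (j + 1) q) := by
    intro k q hq
    rcases k with _ | k
    · obtain ⟨c, rfl⟩ : ∃ c, q = C c := ⟨_, totalDegree_eq_zero_iff_eq_C.1 (by
        have := hq.totalDegree_le; omega)⟩
      rw [pderiv_C, map_zero, homogeneousComponent_of_mem (isHomogeneous_C σ c), if_neg (by omega), map_zero]
    · have h1 := hq.pderiv (i := i)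
      simp only [Nat.add_sub_cancel] at h1
      rw [homogeneousComponent_of_mem h1, homogeneousComponent_of_mem hq]
      by_cases h : j = k
      · simp [h]
      · simp [h]
  conv_lhs => rw [← sum_homogeneousComponent p]
  conv_rhs => rw [← sum_homogeneousComponent p]
  simp only [map_sum]
  exact Finset.sum_congr rfl fun k _ => key k _ (homogeneousComponent_isHomogeneous _ _)

lemma pderiv_mem_LT {σ : Type*} (i : σ) {p : MvPolynomial σ K} {d : ℕ} (hp : p ∈ LT σ K (d + 1)) :
    pderiv i p ∈ LT σ K d := by
  intro j hj
  rw [hc_pderiv, hp _ (by omega), map_zero]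

theorem count_f [IsAlgClosed K] (f : MvPolynomial (Fin (m + 1)) K) {δ δ' N : ℕ}
    (hdeg : f.totalDegree = δ) (h1 : 1 ≤ δ') (h2 : δ' < δ)
    (h3 : ∀ j, δ' < j → j < δ → homogeneousComponent j f = 0)
    (S : MvPolynomial (Fin (m + 1)) K) (B : Fin (m + 1) → MvPolynomial (Fin (m + 1)) K)
    (hS : S.IsHomogeneous N) (hB : ∀ i, (B i).IsHomogeneous (N + 1))
    (hSB : ∑ i, (S * X i - B i) * pderiv i (homogeneousComponent δ f) = 0)
    (hδ' : (δ' : K) ≠ 0)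
    (hz : ∀ x : Fin (m + 1) → K, x ≠ 0 →
      (∀ i, eval x (pderiv i (homogeneousComponent δ f)) = 0) →
      x (Fin.last m) ≠ 0 ∧ eval x S ≠ 0 ∧ (∀ i, eval x (B i) = 0) ∧
        eval x (homogeneousComponent δ' f) ≠ 0) :
    Module.Finite K (MvPolynomial (Fin (m + 1)) K ⧸ Ideal.span (Set.range fun i => pderiv i f)) ∧
    Module.Finite K (MvPolynomial (Fin m) K ⧸
      Ideal.span (Set.range fun i => dh (pderiv i (homogeneousComponent δ f)))) ∧
    Module.finrank K (MvPolynomial (Fin (m + 1)) K ⧸ Ideal.span (Set.range fun i => pderiv i f)) +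
      (δ - δ') * Module.finrank K (MvPolynomial (Fin m) K ⧸
      Ideal.span (Set.range fun i => dh (pderiv i (homogeneousComponent δ f)))) = (δ - 1) ^ (m + 1) := by
  have hfL : f ∈ LT _ K (δ + 1) := by rw [← hdeg]; exact mem_LT_totalDegree f
  set g := homogeneousComponent δ f with hg
  have hgi : ∀ i, homogeneousComponent (δ - 1) (pderiv i f) = pderiv i g := by
    intro i; rw [hc_pderiv, show δ - 1 + 1 = δ by omega]
  have hw : f - g ∈ LT _ K (δ' + 1) := by
    intro j hj
    rw [map_sub, hg, hc_hc]
    rcases lt_trichotomy j δ with h | h | h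
    · rw [h3 j (by omega) h, if_neg (by omega), sub_zero]
    · subst h; simp
    · rw [hfL j (by omega), if_neg (by omega), sub_zero]
  have hu : ∑ i, (S * X i - B i) * pderiv i f = ∑ i, (S * X i - B i) * pderiv i (f - g) := by
    rw [← sub_zero (∑ i, (S * X i - B i) * pderiv i f), ← hSB, ← Finset.sum_sub_distrib]
    refine Finset.sum_congr rfl fun i _ => ?_
    rw [map_sub, mul_sub]
  have hah : ∀ i, (S * X i - B i).IsHomogeneous (N + 1) := fun i =>
    (hS.mul (isHomogeneous_X _ _)).sub (hB i)
  have hdd : N + 1 + (δ - 1 - (δ - δ')) = N + δ' := by omega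
  have hcu : homogeneousComponent (N + δ') (∑ i, (S * X i - B i) * pderiv i f) =
      ∑ i, (S * X i - B i) * pderiv i (homogeneousComponent δ' f) := by
    rw [hu, map_sum]
    refine Finset.sum_congr rfl fun i _ => ?_
    rw [mul_comm, show N + δ' = (δ' - 1) + (N + 1) by omega, hc_mul (hah i), hc_pderiv,
      show δ' - 1 + 1 = δ' by omega, map_sub, hg, hc_hc, if_neg (by omega), sub_zero, mul_comm]
  have := count (fun i => pderiv i f) (D := δ - 1) (e := δ - δ') (k := N + 1) (by omega) (by omega)
    (fun i => pderiv_mem_LT i (by rwa [show δ - 1 + 1 = δ by omega]))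
    (fun i => by
      rw [hgi, ← map_sub]
      rw [show δ - 1 - (δ - δ') + 1 = δ' by omega]
      exact pderiv_mem_LT i hw)
    (fun i => S * X i - B i) hah _ rfl
    (by
      rw [hdd, hu]
      refine Submodule.sum_mem _ fun i _ => ?_
      rw [mul_comm, add_comm N δ', add_assoc]
      exact LT_mul (pderiv_mem_LT i hw) (mem_LT_of_homog (hah i)))
    (by
      intro x hx hx0
      simp only [hgi] at hx0
      obtain ⟨hl, hSx, hBx, hq⟩ := hz x hx hx0
      refine ⟨hl, ?_⟩
      rw [hdd, hcu]
      have hE := (homogeneousComponent_isHomogeneous δ' f).sum_X_mul_pderiv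
      have hE2 := congrArg (eval x) hE
      simp only [map_sum, map_mul, eval_X, nsmul_eq_mul, map_natCast] at hE2
      simp only [map_sum, map_mul, map_sub, eval_X, hBx, sub_zero, mul_assoc]
      rw [← Finset.mul_sum, hE2]
      exact mul_ne_zero hSx (mul_ne_zero hδ' hq))
  have hfun : (fun i => dh (homogeneousComponent (δ - 1) (pderiv i f))) = fun i => dh (pderiv i g) :=
    funext fun i => by rw [hgi]
  rw [hfun] at this
  exact this

end CountF
end Bez
end

open MvPolynomial
noncomputable section
namespace Bez
section Glob
variable {K : Type*} [Field K] {m : ℕ}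

lemma dh_pderiv (k : Fin m) (p : MvPolynomial (Fin (m + 1)) K) :
    pderiv k (dh p) = dh (pderiv k.castSucc p) := by
  classical
  induction p using MvPolynomial.induction_on with
  | C c => simp [dh, algHom_C]
  | add p q hp hq => simp [hp, hq]
  | mul_X p i hp =>
    rw [map_mul, Derivation.leibniz, Derivation.leibniz, map_add, smul_eq_mul, smul_eq_mul,
      smul_eq_mul, smul_eq_mul, map_mul, map_mul, hp]
    congr 2
    refine Fin.lastCases ?_ (fun i => ?_) i
    · simp [dh, pderiv_X]
    · simp [dh, pderiv_X, Pi.single_apply, apply_ite]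

lemma eval_dh (b : Fin m → K) (p : MvPolynomial (Fin (m + 1)) K) :
    eval b (dh p) = eval (sn b 1) p := by
  have : (aeval b : MvPolynomial (Fin m) K →ₐ[K] K).comp dh = aeval (sn b 1) := by
    apply algHom_ext
    intro i
    refine Fin.lastCases ?_ (fun i => ?_) i <;> simp [dh]
  have := congrArg (fun φ : MvPolynomial (Fin (m + 1)) K →ₐ[K] K => φ p) this
  simpa [aeval_eq_eval] using this

lemma dh_inj [Infinite K] {p : MvPolynomial (Fin (m + 1)) K} {d : ℕ} (hp : p.IsHomogeneous d)
    (h : dh p = 0) : p = 0 := by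
  have : X (Fin.last m) * p = 0 := by
    apply MvPolynomial.funext
    intro v
    rw [map_mul, eval_X, map_zero]
    by_cases hv : v (Fin.last m) = 0
    · rw [hv, zero_mul]
    · have h1 : v = (v (Fin.last m)) • sn (fun i => (v (Fin.last m))⁻¹ * v i.castSucc) 1 := by
        ext i
        refine Fin.lastCases ?_ (fun i => ?_) i
        · simp
        · simp [hv]
      have h2 : eval v p = 0 := by
        rw [h1, eval_smul_homog hp, ← eval_dh, h, map_zero, mul_zero]
      rw [h2, mul_zero]
  exact (mul_eq_zero.1 this).resolve_left (X_ne_zero _)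

lemma dh_Hz {d : ℕ} {p : MvPolynomial (Fin m) K} (hp : p ∈ LT _ K (d + 1)) :
    dh (Hz d p (yv m) (tv m)) = p := by
  rw [Hz_map]
  have h1 : (dh : MvPolynomial (Fin (m + 1)) K →ₐ[K] _) (tv m) = 1 := by simp [dh, tv]
  have h2 : (dh : MvPolynomial (Fin (m + 1)) K →ₐ[K] _) ∘ (yv m) = X := by ext1 i; simp [dh, yv]
  rw [h1, h2, Hz_one hp]
  simp

lemma interp {s : ℕ} (a : Fin s → Fin m → K) (ha : Function.Injective a) (j : Fin s) :
    ∃ e : MvPolynomial (Fin m) K, eval (a j) e ≠ 0 ∧ ∀ i, i ≠ j → eval (a i) e = 0 := by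
  classical
  have h : ∀ i, ∃ q : MvPolynomial (Fin m) K, eval (a j) q ≠ 0 ∧ (i ≠ j → eval (a i) q = 0) := by
    intro i
    by_cases hij : i = j
    · exact ⟨1, by simp, fun h => absurd hij h⟩
    · have : a i ≠ a j := fun h => hij (ha h)
      obtain ⟨l, hl⟩ := Function.ne_iff.1 this
      exact ⟨X l - C (a i l), by simpa [sub_eq_zero] using hl.symm, fun _ => by simp⟩
  choose q hq hq' using h
  refine ⟨∏ i, q i, ?_, ?_⟩
  · rw [map_prod]; exact Finset.prod_ne_zero_iff.2 fun i _ => hq i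
  · intro i hi
    rw [map_prod]; exact Finset.prod_eq_zero (Finset.mem_univ i) (hq' i hi)

/-- local Euler type relation -/
def LocE (h : MvPolynomial (Fin m) K) (b : Fin m → K) : Prop :=
  ∃ (σ : MvPolynomial (Fin m) K) (c : Fin m → MvPolynomial (Fin m) K), eval b σ ≠ 0 ∧
    (∀ k, eval b (c k) = 0) ∧ σ * h = ∑ k, c k * pderiv k h

lemma glob_S [Infinite K] {g : MvPolynomial (Fin (m + 1)) K} {δ : ℕ} (hg : g.IsHomogeneous δ)
    (hδ : 1 ≤ δ) {s : ℕ} (a : Fin s → Fin m → K) (ha : Function.Injective a)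
    (hloc : ∀ j, LocE (dh g) (a j)) :
    ∃ (N : ℕ) (S : MvPolynomial (Fin (m + 1)) K) (B : Fin m → MvPolynomial (Fin (m + 1)) K),
      S.IsHomogeneous N ∧ (∀ k, (B k).IsHomogeneous (N + 1)) ∧ (∀ j, eval (sn (a j) 1) S ≠ 0) ∧
      (∀ j k, eval (sn (a j) 1) (B k) = 0) ∧ S * g = ∑ k, B k * pderiv k.castSucc g := by
  classical
  choose e he he' using interp a ha
  choose σ c hσ hc hσc using hloc
  let S0 := ∑ j, e j * σ j
  let C0 : Fin m → MvPolynomial (Fin m) K := fun k => ∑ j, e j * c j k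
  have hrel : S0 * dh g = ∑ k, C0 k * pderiv k (dh g) := by
    simp only [S0, C0, Finset.sum_mul]
    rw [Finset.sum_comm]
    refine Finset.sum_congr rfl fun j _ => ?_
    simp only [mul_assoc]
    rw [hσc, Finset.mul_sum]
  have hS0 : ∀ j, eval (a j) S0 ≠ 0 := by
    intro j
    simp only [S0, map_sum, map_mul]
    rw [Finset.sum_eq_single j]
    · exact mul_ne_zero (he j) (hσ j)
    · intro i _ hij
      rw [he' i j hij.symm, zero_mul]
    · simp
  have hC0 : ∀ j k, eval (a j) (C0 k) = 0 := by
    intro j k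
    simp only [C0, map_sum, map_mul]
    refine Finset.sum_eq_zero fun i _ => ?_
    by_cases hij : i = j
    · subst hij; rw [hc, mul_zero]
    · rw [he' i j (Ne.symm hij), zero_mul]
  let N := S0.totalDegree + ∑ k, (C0 k).totalDegree
  have hSL : S0 ∈ LT _ K (N + 1) := mem_LT_iff_totalDegree.2 (Nat.le_add_right _ _)
  have hCL : ∀ k, C0 k ∈ LT _ K (N + 1 + 1) := fun k => mem_LT_iff_totalDegree.2 (by
    have := Finset.single_le_sum (f := fun k => (C0 k).totalDegree) (fun _ _ => Nat.zero_le _) (Finset.mem_univ k)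
    omega)
  have hyh : ∀ i, (yv m i : MvPolynomial (Fin (m + 1)) K).IsHomogeneous 1 := fun i => isHomogeneous_X _ _
  have hth : (tv m : MvPolynomial (Fin (m + 1)) K).IsHomogeneous 1 := isHomogeneous_X _ _
  refine ⟨N, Hz N S0 (yv m) (tv m), fun k => Hz (N + 1) (C0 k) (yv m) (tv m),
    Hz_homog _ _ _ _ hyh hth, fun k => Hz_homog _ _ _ _ hyh hth, ?_, ?_, ?_⟩
  · intro j
    rw [← eval_dh, dh_Hz hSL]; exact hS0 j
  · intro j k
    rw [← eval_dh, dh_Hz (hCL k)]; exact hC0 j k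
  · rw [← sub_eq_zero]
    refine dh_inj (d := N + δ) ?_ ?_
    · refine ((Hz_homog _ _ _ _ hyh hth).mul hg).sub (IsHomogeneous.sum _ _ _ fun k _ => ?_)
      have := (Hz_homog (N + 1) (C0 k) _ _ hyh hth).mul (hg.pderiv (i := k.castSucc))
      rwa [show N + 1 + (δ - 1) = N + δ by omega] at this
    · rw [map_sub, map_mul, dh_Hz hSL, map_sum, sub_eq_zero, hrel]
      refine Finset.sum_congr rfl fun k _ => ?_
      rw [map_mul, dh_Hz (hCL k), dh_pderiv]

end Glob
end Bez
end

open MvPolynomial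
noncomputable section
namespace Bez
section Mil
variable {K : Type*} [Field K] {m : ℕ}

lemma loc_finrank {R : Type*} [CommRing R] [Algebra K R] (I : Ideal R) (M : Ideal R) [M.IsPrime]
    (P : Ideal (R ⧸ I)) [P.IsPrime] (h : P.comap (Ideal.Quotient.mk I) = M) :
    Module.finrank K (Localization.AtPrime P) =
      Module.finrank K (Localization.AtPrime M ⧸ I.map (algebraMap R (Localization.AtPrime M))) := by
  have hM : ∀ x, x ∈ M ↔ Ideal.Quotient.mk I x ∈ P := by intro x; rw [← h]; rfl
  let φ0 : R →ₐ[K] Localization.AtPrime P :=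
    (IsScalarTower.toAlgHom K (R ⧸ I) (Localization.AtPrime P)).comp (Ideal.Quotient.mkₐ K I)
  have hφ0 : ∀ x, φ0 x = algebraMap (R ⧸ I) (Localization.AtPrime P) (Ideal.Quotient.mk I x) := fun _ => rfl
  have hu : ∀ y : M.primeCompl, IsUnit (φ0 y) := by
    intro y
    rw [hφ0]
    exact IsLocalization.map_units (M := P.primeCompl) _ ⟨_, fun h' => y.2 ((hM _).2 h')⟩
  let φ : Localization.AtPrime M →ₐ[K] Localization.AtPrime P :=
    IsLocalization.liftAlgHom (M := M.primeCompl) (f := φ0) hu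
  have hφ : ∀ x, φ (algebraMap R _ x) = φ0 x := by
    intro x; simp [φ]
  have hsurj : Function.Surjective φ := by
    intro z
    obtain ⟨x, s, rfl⟩ := IsLocalization.exists_mk'_eq P.primeCompl z
    obtain ⟨x, rfl⟩ := Ideal.Quotient.mk_surjective x
    obtain ⟨s, hs⟩ := s
    obtain ⟨s, rfl⟩ := Ideal.Quotient.mk_surjective s
    have hsM : s ∈ M.primeCompl := fun h' => hs ((hM _).1 h')
    refine ⟨IsLocalization.mk' _ x (⟨s, hsM⟩ : M.primeCompl), ?_⟩
    symm
    rw [IsLocalization.mk'_eq_iff_eq_mul]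
    simp only
    rw [← hφ0, ← hφ0, ← hφ, ← hφ, ← map_mul]
    congr 1
    exact (IsLocalization.mk'_spec _ x (⟨s, hsM⟩ : M.primeCompl)).symm
  have hker : RingHom.ker φ = I.map (algebraMap R (Localization.AtPrime M)) := by
    apply le_antisymm
    · intro z hz
      obtain ⟨x, s, rfl⟩ := IsLocalization.exists_mk'_eq M.primeCompl z
      have hz' : φ (IsLocalization.mk' _ x s) = 0 := hz
      have h1 : φ0 x = 0 := by
        rw [← hφ, ← IsLocalization.mk'_spec (Localization.AtPrime M) x s, map_mul, hz', zero_mul]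
      rw [hφ0, IsLocalization.map_eq_zero_iff P.primeCompl] at h1
      obtain ⟨⟨t, ht⟩, htx⟩ := h1
      obtain ⟨t, rfl⟩ := Ideal.Quotient.mk_surjective t
      simp only at htx
      rw [← map_mul, Ideal.Quotient.eq_zero_iff_mem] at htx
      have htM : t ∈ M.primeCompl := fun h' => ht ((hM _).1 h')
      have h2 := Ideal.mem_map_of_mem (algebraMap R (Localization.AtPrime M)) htx
      have h3 : IsLocalization.mk' (Localization.AtPrime M) x s =
        IsLocalization.mk' (Localization.AtPrime M) 1 (s * ⟨t, htM⟩) * algebraMap R _ (t * x) := by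
        rw [mul_comm, IsLocalization.mul_mk'_eq_mk'_of_mul, mul_one, IsLocalization.mk'_eq_iff_eq]
        congr 1
        simp only [Submonoid.coe_mul]; ring
      rw [h3]
      exact Ideal.mul_mem_left _ _ h2
    · rw [Ideal.map_le_iff_le_comap]
      intro x hx
      change φ (algebraMap R _ x) = 0
      rw [hφ, hφ0, Ideal.Quotient.eq_zero_iff_mem.2 hx, map_zero]
  rw [← hker]
  exact (Ideal.quotientKerAlgEquivOfSurjective hsurj).toLinearEquiv.finrank_eq.symm

lemma sum_loc [IsAlgClosed K] (I : Ideal (MvPolynomial (Fin m) K))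
    [Module.Finite K (MvPolynomial (Fin m) K ⧸ I)] {s : ℕ} (a : Fin s → Fin m → K)
    (ha : Function.Injective a) (hz : ∀ b, (∀ p ∈ I, eval b p = 0) ↔ ∃ j, b = a j) :
    Module.finrank K (MvPolynomial (Fin m) K ⧸ I) = ∑ j, Module.finrank K
      (LocAt K (a j) ⧸ I.map (algebraMap _ (LocAt K (a j)))) := by
  classical
  have hart : IsArtinianRing (MvPolynomial (Fin m) K ⧸ I) := IsArtinianRing.of_finite K _
  have hkI : ∀ j, ∀ p ∈ I, eval (a j) p = 0 := fun j => (hz _).2 ⟨j, rfl⟩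
  let P : Fin s → PrimeSpectrum (MvPolynomial (Fin m) K ⧸ I) := fun j =>
    ⟨RingHom.ker (Ideal.Quotient.lift I (eval (a j)) (hkI j)), RingHom.ker_isPrime _⟩
  have hP : ∀ j, (P j).asIdeal.comap (Ideal.Quotient.mk I) = RingHom.ker (eval (a j)) := by
    intro j
    ext x
    simp [P, RingHom.mem_ker]
  have hbij : Function.Bijective P := by
    constructor
    · intro i j hij
      apply ha
      have h1 := hP i
      rw [hij, hP j] at h1
      funext l
      have h2 : (X l - C (a i l) : MvPolynomial (Fin m) K) ∈ RingHom.ker (eval (a j)) := by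
        rw [h1]; simp [RingHom.mem_ker]
      have h3 : a j l - a i l = 0 := by simpa [RingHom.mem_ker] using h2
      exact (sub_eq_zero.1 h3).symm
    · intro Q
      have hmax : Q.asIdeal.IsMaximal := inferInstance
      have hmax2 := Ideal.comap_isMaximal_of_surjective (Ideal.Quotient.mk I) Ideal.Quotient.mk_surjective (K := Q.asIdeal)
      obtain ⟨b, hb⟩ := (isMaximal_iff_eq_vanishingIdeal_singleton (K := K)).1 hmax2
      have hb' : ∀ p, Ideal.Quotient.mk I p ∈ Q.asIdeal ↔ eval b p = 0 := by
        intro p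
        have : p ∈ Q.asIdeal.comap (Ideal.Quotient.mk I) ↔ p ∈ vanishingIdeal K {b} := by rw [hb]
        rw [mem_vanishingIdeal_singleton_iff] at this
        simpa [aeval_eq_eval] using this
      obtain ⟨j, hj⟩ := (hz b).1 (fun p hp => (hb' p).1 (by
        rw [Ideal.Quotient.eq_zero_iff_mem.2 hp]; exact zero_mem _))
      refine ⟨j, ?_⟩
      ext x
      obtain ⟨x, rfl⟩ := Ideal.Quotient.mk_surjective x
      rw [hb', hj]
      simp [P, RingHom.mem_ker]
  have : Fintype (PrimeSpectrum (MvPolynomial (Fin m) K ⧸ I)) := Fintype.ofBijective P hbij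
  rw [IsArtinianRing.finrank_eq_sum_primeSpectrum _ K]
  symm
  refine Fintype.sum_bijective P hbij _ _ fun j => ?_
  have := (P j).isPrime
  exact (loc_finrank (K := K) I _ (P j).asIdeal (hP j)).symm

lemma milnor_eq {g : MvPolynomial (Fin (m + 1)) K} {δ : ℕ} (hg : g.IsHomogeneous δ) (b : Fin m → K)
    (h : (δ : K) = 0 ∨ LocE (dh g) b) :
    Module.finrank K (LocAt K b ⧸ (Ideal.span (Set.range fun i => dh (pderiv i g))).map
      (algebraMap _ (LocAt K b))) = milnorAt b (dh g) := by
  have hE : dh (pderiv (Fin.last m) g) = C (δ : K) * dh g - ∑ k, X k * pderiv k (dh g) := by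
    have h1 := congrArg dh hg.sum_X_mul_pderiv
    rw [Fin.sum_univ_castSucc] at h1
    simp only [map_add, map_sum, map_mul, nsmul_eq_mul, map_natCast] at h1
    have h2 : ∀ k : Fin m, (dh (X k.castSucc) : MvPolynomial (Fin m) K) = X k := by intro k; simp [dh]
    have h3 : (dh (X (Fin.last m)) : MvPolynomial (Fin m) K) = 1 := by simp [dh]
    simp only [h2, h3, one_mul] at h1
    simp only [dh_pderiv, map_natCast]
    rw [← h1]; ring
  rw [milnorAt]
  suffices hI : (Ideal.span (Set.range fun i => dh (pderiv i g))).map (algebraMap _ (LocAt K b)) =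
      Ideal.span (Set.range fun i =>
      algebraMap (MvPolynomial (Fin m) K) (LocAt K b) (pderiv i (dh g))) by rw [hI]
  rw [Ideal.map_span]
  apply le_antisymm
  · rw [Ideal.span_le]
    rintro _ ⟨_, ⟨i, rfl⟩, rfl⟩
    have hk : ∀ k, algebraMap (MvPolynomial (Fin m) K) (LocAt K b) (pderiv k (dh g)) ∈
      Ideal.span (Set.range fun i =>
      algebraMap (MvPolynomial (Fin m) K) (LocAt K b) (pderiv i (dh g))) := fun k =>
        Ideal.subset_span ⟨k, rfl⟩
    refine Fin.lastCases ?_ (fun i => ?_) i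
    · simp only [SetLike.mem_coe]
      rw [hE, map_sub]
      refine Ideal.sub_mem _ ?_ ?_
      · rcases h with h | ⟨σ, c, hσ, -, hσc⟩
        · rw [h]; simp
        · have hunit : IsUnit (algebraMap (MvPolynomial (Fin m) K) (LocAt K b) σ) :=
            IsLocalization.map_units (M := (RingHom.ker (eval b : MvPolynomial (Fin m) K →+* K)).primeCompl) _
              ⟨σ, fun h => hσ h⟩
          rw [map_mul]
          refine Ideal.mul_mem_left _ _ ?_
          rw [← Ideal.unit_mul_mem_iff_mem _ hunit, ← map_mul, hσc, map_sum]
          refine Ideal.sum_mem _ fun k _ => ?_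
          rw [map_mul]
          exact Ideal.mul_mem_left _ _ (hk k)
      · rw [map_sum]
        refine Ideal.sum_mem _ fun k _ => ?_
        rw [map_mul]
        exact Ideal.mul_mem_left _ _ (hk k)
    · simp only [SetLike.mem_coe]
      rw [← dh_pderiv]
      exact hk i
  · rw [Ideal.span_le]
    rintro _ ⟨i, rfl⟩
    refine Ideal.subset_span ⟨_, ⟨i.castSucc, rfl⟩, ?_⟩
    simp only
    rw [dh_pderiv]

end Mil
end Bez
end

open MvPolynomial
noncomputable section
namespace Bez
section Asm
variable {K : Type*} [Field K] {m : ℕ}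

lemma liftPt_eq (b : Fin m → K) : (liftPt (n := m + 1) b) = sn b 1 := by
  ext i
  refine Fin.lastCases ?_ (fun i => ?_) i <;> simp [liftPt]

lemma dehom_eq (F : MvPolynomial (Fin (m + 1)) K) : dehomAtLast F = dh F := by
  unfold dehomAtLast dh
  congr 2

theorem assemble [IsAlgClosed K] (f : MvPolynomial (Fin (m + 1)) K) (δ δ' : ℕ)
    (hdeg : f.totalDegree = δ) (h1 : 1 ≤ δ') (h2 : δ' < δ)
    (h3 : ∀ j, δ' < j → j < δ → homogeneousComponent j f = 0)
    (hδ' : (δ' : K) ≠ 0)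
    (s : ℕ) (a : Fin s → (Fin m → K)) (hainj : Function.Injective a)
    (hzeros : ∀ x : Fin (m + 1) → K, x ≠ 0 →
      ((∀ i, eval x (pderiv i (homogeneousComponent δ f)) = 0) ↔
        ∃ (j : Fin s) (c : K), c ≠ 0 ∧ x = c • sn (a j) 1))
    (hq : ∀ j, eval (sn (a j) 1) (homogeneousComponent δ' f) ≠ 0)
    (hAB : (δ : K) = 0 ∨ ∀ j, LocE (dh (homogeneousComponent δ f)) (a j)) :
    Module.Finite K
      (MvPolynomial (Fin (m + 1)) K ⧸ Ideal.span (Set.range fun i => pderiv i f)) ∧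
    Module.finrank K
        (MvPolynomial (Fin (m + 1)) K ⧸ Ideal.span (Set.range fun i => pderiv i f)) + (δ - δ') *
          ∑ j : Fin s, milnorAt (a j) (dh (homogeneousComponent δ f)) = (δ - 1) ^ (m + 1) := by
  set g := homogeneousComponent δ f with hg
  have hgh : g.IsHomogeneous δ := homogeneousComponent_isHomogeneous _ _
  have hE := hgh.sum_X_mul_pderiv
  obtain ⟨N, S, B, hS, hB, hSB, hSa, hBa⟩ : ∃ (N : ℕ) (S : MvPolynomial (Fin (m + 1)) K)
      (B : Fin (m + 1) → MvPolynomial (Fin (m + 1)) K), S.IsHomogeneous N ∧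
      (∀ i, (B i).IsHomogeneous (N + 1)) ∧ ∑ i, (S * X i - B i) * pderiv i g = 0 ∧
      (∀ j, eval (sn (a j) 1) S ≠ 0) ∧ ∀ j i, eval (sn (a j) 1) (B i) = 0 := by
    rcases hAB with h | h
    · refine ⟨0, 1, 0, isHomogeneous_one _ _, fun i => isHomogeneous_zero _ _ _, ?_, by simp, by simp⟩
      simp only [one_mul, Pi.zero_apply, sub_zero]
      rw [hE, nsmul_eq_mul, ← map_natCast (C (σ := Fin (m + 1)) (R := K)), h, map_zero, zero_mul]
    · obtain ⟨N, S, B, hS, hB, hSa, hBa, hSB⟩ := glob_S hgh (by omega) a hainj h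
      refine ⟨N, S, fun i => C (δ : K) * sn B 0 i, hS, ?_, ?_, hSa, ?_⟩
      · intro i
        rw [← zero_add (N + 1)]
        refine (isHomogeneous_C _ _).mul ?_
        refine Fin.lastCases ?_ (fun i => ?_) i
        · rw [sn_last]; exact isHomogeneous_zero _ _ _
        · rw [sn_cast]; exact hB i
      · simp only [sub_mul, Finset.sum_sub_distrib, mul_assoc]
        rw [← Finset.mul_sum, ← Finset.mul_sum, hE, Fin.sum_univ_castSucc]
        simp only [sn_cast, sn_last, zero_mul, add_zero]
        rw [← hSB, nsmul_eq_mul, map_natCast]; ring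
      · intro j i
        rw [map_mul]
        refine mul_eq_zero_of_right _ ?_
        refine Fin.lastCases ?_ (fun i => ?_) i
        · simp
        · rw [sn_cast]; exact hBa j i
  obtain ⟨hA, hJ, hcount⟩ := count_f f hdeg h1 h2 h3 S B hS hB hSB hδ' (by
    intro x hx hx0
    obtain ⟨j, c, hc, rfl⟩ := (hzeros x hx).1 hx0
    refine ⟨by simpa using hc, ?_, ?_, ?_⟩
    · rw [eval_smul_homog hS]; exact mul_ne_zero (pow_ne_zero _ hc) (hSa j)
    · intro i; rw [eval_smul_homog (hB i), hBa, mul_zero]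
    · rw [eval_smul_homog (homogeneousComponent_isHomogeneous _ _)]
      exact mul_ne_zero (pow_ne_zero _ hc) (hq j))
  refine ⟨hA, ?_⟩
  rw [← hcount, sum_loc _ a hainj]
  · congr 2
    refine Finset.sum_congr rfl fun j _ => ?_
    exact (milnor_eq hgh (a j) (hAB.imp_right fun h => h j)).symm
  · intro b
    have hne : (sn b 1 : Fin (m + 1) → K) ≠ 0 := fun h => by
      have := congrFun h (Fin.last m); simp at this
    have e1 : (∀ p ∈ Ideal.span (Set.range fun i => dh (pderiv i g)), eval b p = 0) ↔
        ∀ i, eval (sn b 1) (pderiv i g) = 0 := by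
      constructor
      · intro h i
        rw [← eval_dh]; exact h _ (Ideal.subset_span ⟨i, rfl⟩)
      · intro h p hp
        have : Ideal.span (Set.range fun i => dh (pderiv i g)) ≤ RingHom.ker (eval b) := by
          rw [Ideal.span_le]
          rintro _ ⟨i, rfl⟩
          change eval b _ = 0
          rw [eval_dh]; exact h i
        exact this hp
    rw [e1, hzeros _ hne]
    constructor
    · rintro ⟨j, c, hc, h⟩
      have hl := congrFun h (Fin.last m)
      have hc1 : c = 1 := by simpa using hl.symm
      subst hc1
      refine ⟨j, ?_⟩
      ext i
      have := congrFun h i.castSucc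
      simpa using this
    · rintro ⟨j, rfl⟩
      exact ⟨j, 1, one_ne_zero, by simp⟩

end Asm
end Bez
end

open MvPolynomial
noncomputable section
namespace Bez
section LocPoly
variable {K : Type*} [Field K] {σ : Type*} [Fintype σ] [DecidableEq σ]

set_option linter.unusedSectionVars false
set_option linter.unusedSimpArgs false

lemma mem_vars_iff (q : MvPolynomial σ K) : q ∈ (idealOfVars σ K) ↔ eval 0 q = 0 := by
  have := mem_pow_idealOfVars_iff' (σ := σ) (R := K) 1 q
  rw [pow_one] at this
  rw [this]
  have h0 : eval 0 q = coeff 0 q := by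
    have : (eval (0 : σ → K)) q = constantCoeff q := by
      rw [MvPolynomial.eval_zero]
    rw [this, constantCoeff_eq]
  rw [h0]
  constructor
  · intro h; exact h 0 (by simp)
  · intro h x hx
    have : x = 0 := by
      rw [← Finsupp.degree_eq_zero_iff]; omega
    rw [this, h]

lemma pderiv_mem_pow (i : σ) (k : ℕ) (q : MvPolynomial σ K) (hq : q ∈ (idealOfVars σ K) ^ (k + 1)) :
    pderiv i q ∈ (idealOfVars σ K) ^ k := by
  induction k generalizing q with
  | zero => simp
  | succ k ih =>
    rw [pow_succ] at hq
    refine Submodule.mul_induction_on hq (fun a ha b hb => ?_) (fun a b ha hb => ?_)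
    · rw [Derivation.leibniz, smul_eq_mul, smul_eq_mul]
      refine add_mem (Ideal.mul_mem_right _ _ ha) ?_
      rw [mul_comm, pow_succ]
      exact Ideal.mul_mem_mul (ih a ha) hb
    · rw [map_add]; exact add_mem ha hb

lemma chain (P : σ → MvPolynomial σ K) (k : σ) (q : MvPolynomial σ K) :
    pderiv k (aeval P q) = ∑ l, aeval P (pderiv l q) * pderiv k (P l) := by
  induction q using MvPolynomial.induction_on with
  | C a => simp [algHom_C]
  | add p q hp hq => simp only [map_add, hp, hq, add_mul, Finset.sum_add_distrib]
  | mul_X p i hp =>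
    simp only [map_mul, Derivation.leibniz, smul_eq_mul, hp, aeval_X, pderiv_X, map_add,
      add_mul, Finset.sum_add_distrib, Finset.mul_sum]
    congr 1
    · rw [Finset.sum_eq_single i]
      · simp
      · intro b _ hb; simp [Pi.single_apply, hb.symm]
      · simp
    · refine Finset.sum_congr rfl fun l _ => by ring

/-- endomorphisms congruent to the identity modulo squares -/
lemma unip (E : MvPolynomial σ K →ₐ[K] MvPolynomial σ K) (hE : ∀ j, E (X j) - X j ∈ (idealOfVars σ K) ^ 2)
    (k : ℕ) (q : MvPolynomial σ K) (hq : q ∈ (idealOfVars σ K) ^ k) : E q - q ∈ (idealOfVars σ K) ^ (k + 1) := by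
  have h21 : ((idealOfVars σ K) ^ 2) ≤ (idealOfVars σ K) := Ideal.pow_le_self two_ne_zero
  have hX : ∀ j, (X j : MvPolynomial σ K) ∈ (idealOfVars σ K) := fun j => Ideal.subset_span ⟨j, rfl⟩
  have h0 : ∀ q : MvPolynomial σ K, E q - q ∈ (idealOfVars σ K) := by
    intro q
    induction q using MvPolynomial.induction_on with
    | C a => simp [algHom_C]
    | add p q hp hq => rw [map_add, add_sub_add_comm]; exact add_mem hp hq
    | mul_X p i hp =>
      rw [map_mul, show E p * E (X i) - p * X i = E p * (E (X i) - X i) + (E p - p) * X i by ring]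
      exact add_mem (Ideal.mul_mem_left _ _ (h21 (hE i))) (Ideal.mul_mem_left _ _ (hX i))
  have h1 : ∀ q ∈ (idealOfVars σ K), E q - q ∈ (idealOfVars σ K) ^ 2 := by
    intro q hq
    refine Submodule.span_induction ?_ ?_ ?_ ?_ hq
    · rintro _ ⟨j, rfl⟩; exact hE j
    · simp
    · intro x y _ _ hx hy; rw [map_add, add_sub_add_comm]; exact add_mem hx hy
    · intro r x hx' hx
      rw [smul_eq_mul, map_mul, show E r * E x - r * x = E r * (E x - x) + (E r - r) * x by ring]
      refine add_mem (Ideal.mul_mem_left _ _ hx) ?_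
      rw [pow_two]; exact Ideal.mul_mem_mul (h0 r) hx'
  induction k generalizing q with
  | zero => simpa using h0 q
  | succ k ih =>
    rw [pow_succ] at hq
    refine Submodule.mul_induction_on hq (fun a ha b hb => ?_) (fun a b ha hb => ?_)
    · rw [map_mul, show E a * E b - a * b = (E a - a) * E b + a * (E b - b) by ring]
      have hEb : E b ∈ (idealOfVars σ K) := by
        have := add_mem (h0 b) hb
        rwa [sub_add_cancel] at this
      refine add_mem ?_ ?_
      · rw [pow_succ]; exact Ideal.mul_mem_mul (ih a ha) hEb
      · rw [show k + 1 + 1 = k + 2 by ring, pow_add]; exact Ideal.mul_mem_mul ha (h1 b hb)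
    · rw [map_add, add_sub_add_comm]; exact add_mem ha hb

lemma unip_surj (E : MvPolynomial σ K →ₐ[K] MvPolynomial σ K) (hE : ∀ j, E (X j) - X j ∈ (idealOfVars σ K) ^ 2)
    (k : ℕ) (q : MvPolynomial σ K) : ∃ q', q - E q' ∈ (idealOfVars σ K) ^ k := by
  induction k with
  | zero => exact ⟨0, by simp⟩
  | succ k ih =>
    obtain ⟨q', h⟩ := ih
    refine ⟨q' + (q - E q'), ?_⟩
    have := neg_mem (unip E hE k _ h)
    convert this using 1
    rw [map_add]; ring

lemma isol [IsAlgClosed K] (H : MvPolynomial σ K) (hi : IsIsolatedCriticalAtZero H) :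
    ∃ (M : ℕ) (v : MvPolynomial σ K), eval 0 v ≠ 0 ∧
      ∀ q ∈ (idealOfVars σ K) ^ M, v * q ∈ Ideal.span (Set.range fun i => pderiv i H) := by
  obtain ⟨-, u, hu, hu2⟩ := hi
  set J := Ideal.span (Set.range fun i => pderiv i H)
  have hle : Ideal.span {u} * (idealOfVars σ K) ≤ J.radical := by
    rw [Ideal.span_singleton_mul_le_iff]
    intro z hz
    rw [← vanishingIdeal_zeroLocus_eq_radical (k := K) (K := K) J, mem_vanishingIdeal_iff]
    intro y hy
    have hy' : ∀ i, eval y (pderiv i H) = 0 := fun i => by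
      simpa using hy (pderiv i H) (Ideal.subset_span ⟨i, rfl⟩)
    rw [map_mul]
    by_cases h : eval y u = 0
    · simp [coe_aeval_eq_eval, h]
    · have := hu2 y h hy'
      subst this
      have := (mem_vars_iff z).1 hz
      rw [mul_eq_zero]; right
      rw [aeval_eq_eval]; exact this
  obtain ⟨M, hM⟩ := Ideal.exists_pow_le_of_le_radical_of_fg hle (IsNoetherian.noetherian _)
  refine ⟨M, u ^ M, by rw [map_pow]; exact pow_ne_zero _ hu, fun q hq => hM ?_⟩
  rw [mul_pow]
  exact Ideal.mul_mem_mul (Ideal.pow_mem_pow (Ideal.mem_span_singleton_self u) M) hq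

lemma mul_span_extract (w : σ → MvPolynomial σ K) (e : MvPolynomial σ K)
    (he : e ∈ (idealOfVars σ K) * Ideal.span (Set.range w)) :
    ∃ c : σ → MvPolynomial σ K, (∀ k, c k ∈ (idealOfVars σ K)) ∧ e = ∑ k, c k * w k := by
  refine Submodule.mul_induction_on he (fun a ha b hb => ?_) ?_
  · obtain ⟨c, hc⟩ := (Ideal.mem_span_range_iff_exists_fun).1 hb
    refine ⟨fun k => a * c k, fun k => Ideal.mul_mem_right _ _ ha, ?_⟩
    rw [← hc, Finset.mul_sum]
    exact Finset.sum_congr rfl fun k _ => by ring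
  · rintro _ _ ⟨c, hc, rfl⟩ ⟨c', hc', rfl⟩
    refine ⟨c + c', fun k => add_mem (hc k) (hc' k), ?_⟩
    simp only [Pi.add_apply, add_mul, Finset.sum_add_distrib]

lemma mem_sup_pow {H q : MvPolynomial σ K} {I : Ideal (MvPolynomial σ K)}
    (h : q ∈ Ideal.span {H} ⊔ I) : ∃ w, q - H * w ∈ I := by
  obtain ⟨a, ha, b, hb, rfl⟩ := Submodule.mem_sup.1 h
  obtain ⟨w, rfl⟩ := Ideal.mem_span_singleton'.1 ha
  exact ⟨w, by convert hb using 1; ring⟩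

theorem loc_poly (H g : MvPolynomial σ K) (L : ℕ) (hL : 2 ≤ L)
    (hH : H ∈ (idealOfVars σ K) ^ 2) (P T : σ → MvPolynomial σ K) (hP : ∀ i, P i ∈ (idealOfVars σ K))
    (ha : aeval P g ∈ Ideal.span {H} ⊔ (idealOfVars σ K) ^ L)
    (hb : ∀ j, X j - aeval P (T j) ∈ Ideal.span {H} ⊔ (idealOfVars σ K) ^ L)
    (hc : ∀ q, aeval P q ∈ Ideal.span {H} ⊔ (idealOfVars σ K) ^ L → q ∈ Ideal.span {g} ⊔ (idealOfVars σ K) ^ L)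
    (α : σ → ℕ) (d : ℕ) (hg : IsWeightedHomogeneous α g d) (hd : (d : K) ≠ 0) :
    ∃ (s : MvPolynomial σ K) (v : σ → MvPolynomial σ K), eval 0 s ≠ 0 ∧ (∀ k, v k ∈ (idealOfVars σ K)) ∧
      s * H - ∑ k, v k * pderiv k H ∈ (idealOfVars σ K) ^ L := by
  have hle : Ideal.span {H} ⊔ (idealOfVars σ K) ^ L ≤ (idealOfVars σ K) ^ 2 :=
    sup_le ((Ideal.span_singleton_le_iff_mem _).2 hH) (Ideal.pow_le_pow_right hL)
  have hPm : ∀ q ∈ (idealOfVars σ K), aeval P q ∈ (idealOfVars σ K) := by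
    intro q hq
    refine Submodule.span_induction ?_ ?_ ?_ ?_ hq
    · rintro _ ⟨j, rfl⟩; simpa using hP j
    · simp
    · intro x y _ _ hx hy; rw [map_add]; exact add_mem hx hy
    · intro r x _ hx
      rw [smul_eq_mul, map_mul]; exact Ideal.mul_mem_left _ _ hx
  have hPL : ∀ q ∈ (idealOfVars σ K) ^ L, aeval P q ∈ (idealOfVars σ K) ^ L := by
    have : ((idealOfVars σ K)).map (aeval P : MvPolynomial σ K →ₐ[K] MvPolynomial σ K) ≤ (idealOfVars σ K) :=
      Ideal.map_le_iff_le_comap.2 fun q hq => hPm q hq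
    intro q hq
    have h2 := Ideal.mem_map_of_mem (aeval P : MvPolynomial σ K →ₐ[K] MvPolynomial σ K) hq
    rw [Ideal.map_pow] at h2
    exact Ideal.pow_right_mono this L h2
  set E : MvPolynomial σ K →ₐ[K] MvPolynomial σ K := (aeval P).comp (aeval T) with hEdef
  have hE : ∀ j, E (X j) - X j ∈ (idealOfVars σ K) ^ 2 := fun j => by
    have := neg_mem (hle (hb j))
    simpa [hEdef] using this
  obtain ⟨q, hq⟩ := unip_surj E hE L H
  -- `H ≡ G z`
  have hq2 : aeval P (aeval T q) ∈ Ideal.span {H} ⊔ (idealOfVars σ K) ^ L := by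
    have := sub_mem (Submodule.mem_sup_left (T := (idealOfVars σ K) ^ L) (Ideal.mem_span_singleton_self H))
      (Submodule.mem_sup_right (S := Ideal.span {H}) hq)
    simpa [hEdef] using this
  obtain ⟨z0, hz0⟩ := mem_sup_pow (hc _ hq2)
  set G := aeval P g with hG
  set z := aeval P z0 with hz
  have he : H - G * z ∈ (idealOfVars σ K) ^ L := by
    have := add_mem hq (hPL _ hz0)
    rw [map_sub, map_mul] at this
    convert this using 1
    simp [hEdef, hG, hz]
  obtain ⟨w, hw⟩ := mem_sup_pow ha
  -- Jacobian
  let J : Matrix σ σ (MvPolynomial σ K) := fun l k => pderiv k (P l)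
  have hdet : eval 0 J.det ≠ 0 := by
    let A : Matrix σ σ K := fun j l => eval 0 (aeval P (pderiv l (T j)))
    have h1 : A * (J.map (eval (0 : σ → K))) = 1 := by
      ext j k
      have h2 := pderiv_mem_pow k 1 _ (hle (hb j))
      rw [pow_one, mem_vars_iff, map_sub, chain, map_sub, map_sum] at h2
      rw [Matrix.mul_apply, Matrix.one_apply]
      simp only [map_mul] at h2
      rw [pderiv_X, sub_eq_zero] at h2
      refine Eq.trans h2.symm ?_
      by_cases hjk : j = k
      · subst hjk; simp
      · simp [hjk, Pi.single_apply, Ne.symm hjk]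
    have h3 := congrArg Matrix.det h1
    rw [Matrix.det_mul, Matrix.det_one] at h3
    have h4 : eval 0 J.det = (J.map (eval (0 : σ → K))).det := by
      rw [RingHom.map_det]; rfl
    rw [h4]
    exact right_ne_zero_of_mul_eq_one h3
  let s0 : MvPolynomial σ K := C (d : K) * J.det
  let v : σ → MvPolynomial σ K := fun k => ∑ l, J.adjugate k l * (C (α l : K) * P l)
  have hv : ∀ k, v k ∈ (idealOfVars σ K) := fun k => Ideal.sum_mem _ fun l _ =>
    Ideal.mul_mem_left _ _ (Ideal.mul_mem_left _ _ (hP l))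
  have hDG : ∑ k, v k * pderiv k G = s0 * G := by
    have e1 : ∑ l, C (α l : K) * P l * aeval P (pderiv l g) = C (d : K) * G := by
      have := congrArg (aeval P : MvPolynomial σ K →ₐ[K] MvPolynomial σ K)
        hg.sum_weight_X_mul_pderiv
      simp only [map_sum, map_nsmul, map_mul, aeval_X, nsmul_eq_mul] at this
      rw [map_natCast, ← hG] at *
      rw [← this]
      refine Finset.sum_congr rfl fun l _ => ?_
      rw [map_natCast, map_natCast]; ring
    have e2 : ∀ l l', ∑ k, J l' k * J.adjugate k l = if l' = l then J.det else 0 := by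
      intro l l'
      have := congrFun (congrFun (Matrix.mul_adjugate J) l') l
      rw [Matrix.mul_apply] at this
      rw [this, Matrix.smul_apply, Matrix.one_apply]; simp
    calc ∑ k, v k * pderiv k G
        = ∑ k, ∑ l, ∑ l', (J l' k * J.adjugate k l) * (C (α l : K) * P l *
            aeval P (pderiv l' g)) := by
          refine Finset.sum_congr rfl fun k _ => ?_
          rw [hG, chain, Finset.sum_mul_sum]
          exact Finset.sum_congr rfl fun l _ => Finset.sum_congr rfl fun l' _ => by
            simp only [J]; ring
      _ = ∑ l, ∑ l', (∑ k, J l' k * J.adjugate k l) * (C (α l : K) * P l *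
            aeval P (pderiv l' g)) := by
          rw [Finset.sum_comm]
          refine Finset.sum_congr rfl fun l _ => ?_
          rw [Finset.sum_comm]
          exact Finset.sum_congr rfl fun l' _ => by rw [Finset.sum_mul]
      _ = ∑ l, J.det * (C (α l : K) * P l * aeval P (pderiv l g)) := by
          refine Finset.sum_congr rfl fun l _ => ?_
          simp only [e2, ite_mul, zero_mul]
          rw [Finset.sum_ite_eq' ]; simp
      _ = s0 * G := by rw [← Finset.mul_sum, e1]; simp only [s0]; ring
  let D : MvPolynomial σ K → MvPolynomial σ K := fun q => ∑ k, v k * pderiv k q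
  have hDadd : ∀ a b, D (a + b) = D a + D b := fun a b => by
    simp only [D, map_add, mul_add, Finset.sum_add_distrib]
  have hDmul : ∀ a b, D (a * b) = D a * b + a * D b := fun a b => by
    simp only [D, Derivation.leibniz, smul_eq_mul, mul_add, Finset.sum_add_distrib,
      Finset.mul_sum, Finset.sum_mul]
    rw [add_comm]
    congr 1 <;> exact Finset.sum_congr rfl fun k _ => by ring
  have hDL : ∀ e ∈ (idealOfVars σ K) ^ L, D e ∈ (idealOfVars σ K) ^ L := by
    intro e he
    obtain ⟨L', rfl⟩ : ∃ L', L = L' + 1 := ⟨L - 1, by omega⟩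
    refine Ideal.sum_mem _ fun k _ => ?_
    rw [pow_succ']
    exact Ideal.mul_mem_mul (hv k) (pderiv_mem_pow k L' e he)
  refine ⟨s0 + w * D z, v, ?_, hv, ?_⟩
  · have : eval 0 (D z) = 0 := (mem_vars_iff _).1 (Ideal.sum_mem _ fun k _ =>
      Ideal.mul_mem_right _ _ (hv k))
    rw [map_add, (map_mul (eval 0) w (D z) :), this, mul_zero, add_zero]
    simp only [s0, map_mul, eval_C]
    exact mul_ne_zero hd hdet
  · have hDH : D H = s0 * G * z + G * D z + D (H - G * z) := by
      have : H = G * z + (H - G * z) := by ring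
      conv_lhs => rw [this]
      rw [hDadd, hDmul]
      congr 3
    have : (s0 + w * D z) * H - ∑ k, v k * pderiv k H
        = s0 * (H - G * z) - (G - H * w) * D z - D (H - G * z) := by
      change _ - D H = _
      rw [hDH]; ring
    rw [this]
    exact sub_mem (sub_mem (Ideal.mul_mem_left _ _ he) (Ideal.mul_mem_right _ _ hw)) (hDL _ he)

end LocPoly
end Bez
end

open MvPolynomial
noncomputable section
namespace Bez
section Pow
set_option linter.unusedSectionVars false
set_option linter.unusedSimpArgs false
variable {K : Type*} [Field K] {σ : Type*} [Fintype σ] [DecidableEq σ]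

/-- the ideal of the origin in the power series ring -/
abbrev pmax (K : Type*) [Field K] (σ : Type*) : Ideal (MvPowerSeries σ K) :=
  (idealOfVars σ K).map (algebraMap (MvPolynomial σ K) (MvPowerSeries σ K))

lemma pow_decomp (L : ℕ) (z : MvPowerSeries σ K)
    (hz : ∀ x : σ →₀ ℕ, x.degree < L → MvPowerSeries.coeff x z = 0) : z ∈ (pmax K σ) ^ L := by
  induction L generalizing z with
  | zero => simp
  | succ L ih =>
    have hex : ∀ e : σ →₀ ℕ, e ≠ 0 → ∃ i, e i ≠ 0 := fun e he => by
      by_contra h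
      push Not at h
      exact he (Finsupp.ext h)
    rcases isEmpty_or_nonempty σ with hemp | hne
    · have : z = 0 := by
        ext e
        rw [hz e (by rw [Subsingleton.elim e 0]; simp)]; simp
      rw [this]; exact zero_mem _
    choose! ι hι using hex
    let w : σ → MvPowerSeries σ K := fun i e =>
      if ι (e + Finsupp.single i 1) = i then MvPowerSeries.coeff (e + Finsupp.single i 1) z else 0
    have hw : ∀ i, w i ∈ (pmax K σ) ^ L := fun i => ih _ fun x hx => by
      change (if _ then _ else _) = _
      split_ifs
      · apply hz
        rw [map_add, Finsupp.degree_single]; omega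
      · rfl
    have hsum : z = ∑ i, MvPowerSeries.X i * w i := by
      ext e
      rw [map_sum]
      have hterm : ∀ i, MvPowerSeries.coeff e (MvPowerSeries.X i * w i)
          = if e i ≠ 0 ∧ ι e = i then MvPowerSeries.coeff e z else 0 := by
        intro i
        rw [MvPowerSeries.X_def, MvPowerSeries.coeff_monomial_mul]
        by_cases h : e i = 0
        · rw [if_neg, if_neg]
          · simp [h]
          · intro hle
            have := hle i
            simp [h] at this
        · have hle : Finsupp.single i 1 ≤ e := by
            rw [Finsupp.single_le_iff]; omega
          rw [if_pos hle, one_mul]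
          change (if _ then _ else _) = _
          rw [tsub_add_cancel_of_le hle]
          simp [h]
      simp only [hterm]
      by_cases h : e = 0
      · subst h
        simp only [Finsupp.coe_zero, Pi.zero_apply, ne_eq, not_true_eq_false, false_and, if_false,
          Finset.sum_const_zero]
        exact hz 0 (by simp)
      · rw [Finset.sum_eq_single (ι e)]
        · rw [if_pos ⟨hι e h, rfl⟩]
        · intro b _ hb
          rw [if_neg]; rintro ⟨-, h2⟩; exact hb h2.symm
        · simp
    rw [hsum]
    refine Ideal.sum_mem _ fun i _ => ?_
    rw [pow_succ']
    refine Ideal.mul_mem_mul ?_ (hw i)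
    have : (X i : MvPolynomial σ K) ∈ idealOfVars σ K := Ideal.subset_span ⟨i, rfl⟩
    have := Ideal.mem_map_of_mem (algebraMap (MvPolynomial σ K) (MvPowerSeries σ K)) this
    simpa [MvPowerSeries.algebraMap_apply'] using this

lemma trunc_ker (L : ℕ) (z : MvPowerSeries σ K) :
    MvPowerSeries.truncTotalAlgHom σ K L z = 0 ↔ z ∈ (pmax K σ) ^ L := by
  constructor
  · intro h
    apply pow_decomp
    intro x hx
    rw [MvPowerSeries.truncTotalAlgHom_apply, Ideal.Quotient.eq_zero_iff_mem,
      mem_pow_idealOfVars_iff'] at h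
    have := h x hx
    rwa [MvPowerSeries.coeff_truncTotal _ hx] at this
  · intro h
    rw [pmax, ← Ideal.map_pow] at h
    have : Ideal.map (algebraMap (MvPolynomial σ K) (MvPowerSeries σ K)) (idealOfVars σ K ^ L) ≤
        RingHom.ker (MvPowerSeries.truncTotalAlgHom σ K L) := by
      rw [Ideal.map_le_iff_le_comap]
      intro q hq
      rw [Ideal.mem_comap, RingHom.mem_ker, AlgHom.commutes]
      exact Ideal.Quotient.eq_zero_iff_mem.2 hq
    exact this h

lemma mem_pmax (z : MvPowerSeries σ K) : z ∈ pmax K σ ↔ MvPowerSeries.constantCoeff z = 0 := by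
  have := trunc_ker 1 z
  have h1 : z ∈ pmax K σ ^ 1 ↔ z ∈ pmax K σ := by rw [pow_one]
  rw [← h1, ← this, MvPowerSeries.truncTotalAlgHom_apply, Ideal.Quotient.eq_zero_iff_mem, pow_one,
    mem_vars_iff, MvPolynomial.eval_zero, MvPowerSeries.constantCoeff_truncTotal_eq_ite]
  simp

lemma sub_trunc (L : ℕ) (z : MvPowerSeries σ K) :
    z - ((MvPowerSeries.truncTotal L z : MvPolynomial σ K) : MvPowerSeries σ K) ∈ (pmax K σ) ^ L := by
  apply pow_decomp
  intro x hx
  rw [map_sub, MvPolynomial.coeff_coe, MvPowerSeries.coeff_truncTotal _ hx, sub_self]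

/-- truncated quotient map -/
def psi (H : MvPolynomial σ K) (L : ℕ) :
    (MvPowerSeries σ K ⧸ Ideal.span {(H : MvPowerSeries σ K)}) →ₐ[K]
      MvPolynomial σ K ⧸ (Ideal.span {H} ⊔ idealOfVars σ K ^ L) :=
  Ideal.Quotient.liftₐ _
    ((Ideal.Quotient.factorₐ K (le_sup_right : idealOfVars σ K ^ L ≤
        Ideal.span {H} ⊔ idealOfVars σ K ^ L)).comp
      ((MvPowerSeries.truncTotalAlgHom σ K L).restrictScalars K)) (by
    intro a ha
    obtain ⟨w, rfl⟩ := Ideal.mem_span_singleton'.1 ha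
    rw [map_mul]
    have : MvPowerSeries.truncTotalAlgHom σ K L (H : MvPowerSeries σ K) = Ideal.Quotient.mk _ H :=
      (MvPowerSeries.truncTotalAlgHom σ K L).commutes H
    simp only [AlgHom.comp_apply, AlgHom.restrictScalars_apply]
    rw [this]
    have h0 : Ideal.Quotient.factorₐ K (le_sup_right : idealOfVars σ K ^ L ≤
        Ideal.span {H} ⊔ idealOfVars σ K ^ L) (Ideal.Quotient.mk _ H) = 0 := by
      rw [Ideal.Quotient.factorₐ_apply_mk, Ideal.Quotient.eq_zero_iff_mem]
      exact Submodule.mem_sup_left (Ideal.mem_span_singleton_self H)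
    rw [h0, mul_zero])

lemma psi_mk (H : MvPolynomial σ K) (L : ℕ) (z : MvPowerSeries σ K) :
    psi H L (Ideal.Quotient.mk _ z) = Ideal.Quotient.mk _ (MvPowerSeries.truncTotal L z) := rfl

lemma psi_coe (H : MvPolynomial σ K) (L : ℕ) (q : MvPolynomial σ K) :
    psi H L (Ideal.Quotient.mk _ (q : MvPowerSeries σ K)) = Ideal.Quotient.mk _ q := by
  have h : MvPowerSeries.truncTotalAlgHom σ K L (q : MvPowerSeries σ K) = Ideal.Quotient.mk _ q :=
      (MvPowerSeries.truncTotalAlgHom σ K L).commutes q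
  have : psi H L (Ideal.Quotient.mk _ (q : MvPowerSeries σ K)) =
    Ideal.Quotient.factorₐ K (le_sup_right : idealOfVars σ K ^ L ≤
        Ideal.span {H} ⊔ idealOfVars σ K ^ L)
        (MvPowerSeries.truncTotalAlgHom σ K L (q : MvPowerSeries σ K)) := rfl
  rw [this, h]; rfl

/-- maximal ideal of the quotient -/
abbrev qmax (H : MvPolynomial σ K) :
    Ideal (MvPowerSeries σ K ⧸ Ideal.span {(H : MvPowerSeries σ K)}) :=
  (pmax K σ).map (Ideal.Quotient.mk _)

lemma psi_ker (H : MvPolynomial σ K) (L : ℕ)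
    (a : MvPowerSeries σ K ⧸ Ideal.span {(H : MvPowerSeries σ K)}) :
    psi H L a = 0 ↔ a ∈ (qmax H) ^ L := by
  obtain ⟨z, rfl⟩ := Ideal.Quotient.mk_surjective a
  rw [qmax, ← Ideal.map_pow]
  constructor
  · intro h
    rw [psi_mk, Ideal.Quotient.eq_zero_iff_mem] at h
    obtain ⟨w, hw⟩ := mem_sup_pow h
    have h1 : z = H * w + ((z - ((MvPowerSeries.truncTotal L z : MvPolynomial σ K) :
        MvPowerSeries σ K)) + ((MvPowerSeries.truncTotal L z - H * w : MvPolynomial σ K) :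
        MvPowerSeries σ K)) := by
      have : ((MvPowerSeries.truncTotal L z - H * w : MvPolynomial σ K) :
        MvPowerSeries σ K) = ((MvPowerSeries.truncTotal L z : MvPolynomial σ K) :
          MvPowerSeries σ K) - H * w := by
        rw [← MvPolynomial.coe_mul]
        exact (map_sub (coeToMvPowerSeries.ringHom (R := K) (σ := σ)) _ _)
      rw [this]; ring
    rw [h1, map_add, map_mul, Ideal.Quotient.eq_zero_iff_mem.2 (Ideal.mem_span_singleton_self _),
      zero_mul, zero_add]
    apply Ideal.mem_map_of_mem
    refine add_mem (sub_trunc L z) ?_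
    rw [pmax, ← Ideal.map_pow]
    have := Ideal.mem_map_of_mem (algebraMap (MvPolynomial σ K) (MvPowerSeries σ K)) hw
    rwa [MvPowerSeries.algebraMap_apply', Algebra.algebraMap_self, MvPowerSeries.map_id] at this
  · intro h
    have : Ideal.map (Ideal.Quotient.mk (Ideal.span {(H : MvPowerSeries σ K)})) (pmax K σ ^ L) ≤
        RingHom.ker (psi H L) := by
      rw [Ideal.map_le_iff_le_comap]
      intro q hq
      rw [Ideal.mem_comap, RingHom.mem_ker, psi_mk]
      have h2 := (trunc_ker L q).2 hq
      rw [MvPowerSeries.truncTotalAlgHom_apply, Ideal.Quotient.eq_zero_iff_mem] at h2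
      exact Ideal.Quotient.eq_zero_iff_mem.2 (Submodule.mem_sup_right h2)
    exact this h

lemma rep {H g : MvPolynomial σ K} (hg0 : eval 0 g = 0)
    (Φ : (MvPowerSeries σ K ⧸ Ideal.span {(H : MvPowerSeries σ K)}) ≃ₐ[K]
      MvPowerSeries σ K ⧸ Ideal.span {(g : MvPowerSeries σ K)})
    (z w : MvPowerSeries σ K) (hz : z ∈ pmax K σ)
    (h : Φ (Ideal.Quotient.mk _ w) = Ideal.Quotient.mk _ z) : w ∈ pmax K σ := by
  rw [mem_pmax] at *
  by_contra hw
  have hu : IsUnit w := MvPowerSeries.isUnit_iff_constantCoeff.2 (isUnit_iff_ne_zero.2 hw)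
  have hu2 := (hu.map (Ideal.Quotient.mk (Ideal.span {(H : MvPowerSeries σ K)}))).map Φ
  rw [h] at hu2
  obtain ⟨b, hb⟩ := hu2.exists_right_inv
  obtain ⟨y, rfl⟩ := Ideal.Quotient.mk_surjective b
  rw [← map_mul, ← map_one (Ideal.Quotient.mk _), Ideal.Quotient.eq] at hb
  obtain ⟨c, hc⟩ := Ideal.mem_span_singleton'.1 hb
  have := congrArg MvPowerSeries.constantCoeff hc
  rw [map_mul, map_sub, map_mul, hz, map_one, zero_mul, zero_sub] at this
  rw [MvPolynomial.eval_zero] at hg0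
  have h3 : MvPowerSeries.constantCoeff (g : MvPowerSeries σ K) = 0 := by
    rw [← MvPowerSeries.coeff_zero_eq_constantCoeff_apply, MvPolynomial.coeff_coe,
      ← constantCoeff_eq, hg0]
  rw [h3, mul_zero] at this
  simp at this

lemma qmax_pow {H g : MvPolynomial σ K} (hH0 : eval 0 H = 0)
    (Φ : (MvPowerSeries σ K ⧸ Ideal.span {(H : MvPowerSeries σ K)}) ≃ₐ[K]
      MvPowerSeries σ K ⧸ Ideal.span {(g : MvPowerSeries σ K)}) (L : ℕ)
    (a) (ha : a ∈ (qmax H) ^ L) : Φ a ∈ (qmax g) ^ L := by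
  have h1 : (qmax H).map Φ ≤ qmax g := by
    rw [Ideal.map_le_iff_le_comap, qmax, Ideal.map_le_iff_le_comap]
    intro z hz
    obtain ⟨w, hw⟩ := Ideal.Quotient.mk_surjective (Φ (Ideal.Quotient.mk _ z))
    have : w ∈ pmax K σ := rep hH0 Φ.symm z w hz (by rw [hw]; simp)
    change Φ (Ideal.Quotient.mk _ z) ∈ qmax g
    rw [← hw]
    exact Ideal.mem_map_of_mem _ this
  have h2 := Ideal.mem_map_of_mem Φ ha
  rw [Ideal.map_pow] at h2
  exact Ideal.pow_right_mono h1 L h2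

lemma eval_g_zero {H g : MvPolynomial σ K} (hH0 : eval 0 H = 0)
    (Φ : (MvPowerSeries σ K ⧸ Ideal.span {(H : MvPowerSeries σ K)}) ≃ₐ[K]
      MvPowerSeries σ K ⧸ Ideal.span {(g : MvPowerSeries σ K)}) : eval 0 g = 0 := by
  by_contra h
  have hu : IsUnit (g : MvPowerSeries σ K) := by
    rw [MvPowerSeries.isUnit_iff_constantCoeff, isUnit_iff_ne_zero,
      ← MvPowerSeries.coeff_zero_eq_constantCoeff_apply, MvPolynomial.coeff_coe,
      ← constantCoeff_eq]
    rwa [MvPolynomial.eval_zero] at h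
  have h1 : (1 : MvPowerSeries σ K ⧸ Ideal.span {(g : MvPowerSeries σ K)}) = 0 := by
    rw [← map_one (Ideal.Quotient.mk _), Ideal.Quotient.eq_zero_iff_mem,
      Ideal.span_singleton_eq_top.2 hu]
    trivial
  have h2 := congrArg Φ.symm h1
  rw [map_one, map_zero, ← map_one (Ideal.Quotient.mk _), Ideal.Quotient.eq_zero_iff_mem] at h2
  obtain ⟨c, hc⟩ := Ideal.mem_span_singleton'.1 h2
  have := congrArg MvPowerSeries.constantCoeff hc
  rw [MvPolynomial.eval_zero] at hH0
  have h3 : MvPowerSeries.constantCoeff (H : MvPowerSeries σ K) = 0 := by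
    rw [← MvPowerSeries.coeff_zero_eq_constantCoeff_apply, MvPolynomial.coeff_coe,
      ← constantCoeff_eq, hH0]
  rw [map_mul, h3, mul_zero, map_one] at this
  exact zero_ne_one this

theorem trunc_iso {H g : MvPolynomial σ K} (hH0 : eval 0 H = 0)
    (Φ : (MvPowerSeries σ K ⧸ Ideal.span {(H : MvPowerSeries σ K)}) ≃ₐ[K]
      MvPowerSeries σ K ⧸ Ideal.span {(g : MvPowerSeries σ K)}) (L : ℕ) :
    ∃ P T : σ → MvPolynomial σ K, (∀ i, P i ∈ idealOfVars σ K) ∧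
      aeval P g ∈ Ideal.span {H} ⊔ idealOfVars σ K ^ L ∧
      (∀ j, X j - aeval P (T j) ∈ Ideal.span {H} ⊔ idealOfVars σ K ^ L) ∧
      (∀ q, aeval P q ∈ Ideal.span {H} ⊔ idealOfVars σ K ^ L →
        q ∈ Ideal.span {g} ⊔ idealOfVars σ K ^ L) := by
  have hg0 := eval_g_zero hH0 Φ
  have hp : ∀ i : σ, ∃ p : MvPowerSeries σ K, Ideal.Quotient.mk _ p =
      Φ.symm (Ideal.Quotient.mk _ ((X i : MvPolynomial σ K) : MvPowerSeries σ K)) :=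
    fun i => Ideal.Quotient.mk_surjective _
  have ht : ∀ i : σ, ∃ p : MvPowerSeries σ K, Ideal.Quotient.mk _ p =
      Φ (Ideal.Quotient.mk _ ((X i : MvPolynomial σ K) : MvPowerSeries σ K)) :=
    fun i => Ideal.Quotient.mk_surjective _
  choose p hp using hp
  choose t ht using ht
  let P : σ → MvPolynomial σ K := fun i => MvPowerSeries.truncTotal L (p i)
  let T : σ → MvPolynomial σ K := fun i => MvPowerSeries.truncTotal L (t i)
  have key : ∀ q : MvPolynomial σ K, psi H L (Φ.symm (Ideal.Quotient.mk _ (q : MvPowerSeries σ K)))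
      = Ideal.Quotient.mk _ (aeval P q) := by
    intro q
    let f1 : MvPolynomial σ K →ₐ[K] MvPolynomial σ K ⧸ (Ideal.span {H} ⊔ idealOfVars σ K ^ L) :=
      (psi H L).comp (Φ.symm.toAlgHom.comp ((Ideal.Quotient.mkₐ K _).comp
        (coeToMvPowerSeries.algHom K)))
    let f2 : MvPolynomial σ K →ₐ[K] MvPolynomial σ K ⧸ (Ideal.span {H} ⊔ idealOfVars σ K ^ L) :=
      (Ideal.Quotient.mkₐ K _).comp (aeval P)
    have hf : f1 = f2 := by
      apply MvPolynomial.algHom_ext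
      intro i
      simp only [f1, f2, AlgHom.comp_apply, aeval_X, Ideal.Quotient.mkₐ_eq_mk,
        coeToMvPowerSeries.algHom_apply, Algebra.algebraMap_self, MvPowerSeries.map_id, RingHom.id_apply]
      change psi H L (Φ.symm (Ideal.Quotient.mk _ _)) = _
      rw [← hp, psi_mk]
    have := congrArg (fun f => f q) hf
    simp only [f1, f2, AlgHom.comp_apply, Ideal.Quotient.mkₐ_eq_mk,
        coeToMvPowerSeries.algHom_apply, Algebra.algebraMap_self, MvPowerSeries.map_id, RingHom.id_apply] at this
    exact this
  refine ⟨P, T, fun i => ?_, ?_, fun j => ?_, fun q hq => ?_⟩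
  · have hX : ((X i : MvPolynomial σ K) : MvPowerSeries σ K) ∈ pmax K σ := by
      rw [mem_pmax]; simp
    have := rep hg0 Φ _ (p i) hX (by rw [hp]; simp)
    rw [mem_pmax] at this
    rw [mem_vars_iff, MvPolynomial.eval_zero]
    simp [P, MvPowerSeries.constantCoeff_truncTotal_eq_ite, this]
  · rw [← Ideal.Quotient.eq_zero_iff_mem, ← key,
      Ideal.Quotient.eq_zero_iff_mem.2 (Ideal.mem_span_singleton_self _), map_zero, map_zero]
  · rw [← Ideal.Quotient.eq, ← key, ← psi_coe, ← sub_eq_zero, ← map_sub, psi_ker]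
    have h1 : Ideal.Quotient.mk (Ideal.span {(g : MvPowerSeries σ K)}) (t j - (T j : MvPowerSeries σ K))
        ∈ (qmax g) ^ L := by
      rw [qmax, ← Ideal.map_pow]
      exact Ideal.mem_map_of_mem _ (sub_trunc L (t j))
    have h2 := qmax_pow hg0 Φ.symm L _ h1
    rw [map_sub, ht, map_sub, AlgEquiv.symm_apply_apply] at h2
    exact h2
  · rw [← Ideal.Quotient.eq_zero_iff_mem, ← key, psi_ker] at hq
    have := qmax_pow hH0 Φ L _ hq
    rw [AlgEquiv.apply_symm_apply, ← psi_ker, psi_coe, Ideal.Quotient.eq_zero_iff_mem] at this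
    exact this

theorem loc_main [IsAlgClosed K] (H : MvPolynomial σ K) (d : ℕ) (hd : (d : K) ≠ 0)
    (hH0 : eval 0 H = 0) (hi : IsIsolatedCriticalAtZero H) (hw : WeightedHomogSing H d) :
    ∃ (s : MvPolynomial σ K) (c : σ → MvPolynomial σ K), eval 0 s ≠ 0 ∧ (∀ k, eval 0 (c k) = 0) ∧
      s * H = ∑ k, c k * pderiv k H := by
  obtain ⟨g, ⟨α, -, -, hg⟩, ⟨Φ⟩⟩ := hw
  obtain ⟨M, v, hv, hvM⟩ := isol H hi
  have hH2 : H ∈ idealOfVars σ K ^ 2 := by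
    rw [mem_pow_idealOfVars_iff']
    intro x hx
    by_cases hx0 : x = 0
    · subst hx0
      rw [MvPolynomial.eval_zero, constantCoeff_eq] at hH0
      exact hH0
    · obtain ⟨i, hi'⟩ : ∃ i, x i ≠ 0 := by
        by_contra h
        push Not at h
        exact hx0 (Finsupp.ext h)
      have hx1 : x = Finsupp.single i 1 := by
        have hle : Finsupp.single i 1 ≤ x := by rw [Finsupp.single_le_iff]; omega
        have h3 := tsub_add_cancel_of_le hle
        have h4 := congrArg Finsupp.degree h3
        rw [map_add, Finsupp.degree_single] at h4
        have h5 : x - Finsupp.single i 1 = 0 := by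
          rw [← Finsupp.degree_eq_zero_iff]; omega
        rw [h5, zero_add] at h3
        exact h3.symm
      have h6 := hi.1 i
      rw [MvPolynomial.eval_zero, constantCoeff_eq, coeff_pderiv] at h6
      simpa [hx1] using h6
  obtain ⟨P, T, hP, ha, hb, hc⟩ := trunc_iso hH0 Φ (M + 2)
  obtain ⟨s, c, hs, hcm, he⟩ := loc_poly H g (M + 2) (by omega) hH2 P T hP ha hb hc α d hg hd
  have he2 : v * (s * H - ∑ k, c k * pderiv k H) ∈
      idealOfVars σ K * Ideal.span (Set.range fun i => pderiv i H) := by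
    have : s * H - ∑ k, c k * pderiv k H ∈ idealOfVars σ K * idealOfVars σ K ^ M := by
      rw [← pow_succ']
      exact Ideal.pow_le_pow_right (by omega) he
    refine Submodule.mul_induction_on this (fun a ha b hb => ?_) (fun a b ha hb => ?_)
    · rw [show v * (a * b) = a * (v * b) by ring]
      exact Ideal.mul_mem_mul ha (hvM b hb)
    · rw [mul_add]; exact add_mem ha hb
  obtain ⟨c', hc', he3⟩ := mul_span_extract _ _ he2
  refine ⟨v * s, fun k => v * c k + c' k, by rw [map_mul]; exact mul_ne_zero hv hs, fun k => ?_, ?_⟩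
  · rw [← mem_vars_iff]
    exact add_mem (Ideal.mul_mem_left _ _ (hcm k)) (hc' k)
  · simp only [add_mul, Finset.sum_add_distrib]
    rw [← he3, mul_sub, Finset.mul_sum]
    simp only [mul_assoc]
    ring

end Pow
end Bez
end

open MvPolynomial
noncomputable section
namespace Bez
section Fin
set_option linter.unusedSectionVars false
set_option linter.unusedSimpArgs false
variable {K : Type*} [Field K] {m : ℕ}

/-- index equivalence -/
def ei (m : ℕ) : Fin m ≃ {i : Fin (m + 1) // i ≠ Fin.last m} where
  toFun k := ⟨k.castSucc, (Fin.castSucc_lt_last k).ne⟩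
  invFun i := i.1.castPred i.2
  left_inv k := by simp
  right_inv i := by simp

/-- translation back to the affine chart -/
def tau (b : Fin m → K) : MvPolynomial {i : Fin (m + 1) // i ≠ Fin.last m} K →ₐ[K]
    MvPolynomial (Fin m) K :=
  aeval fun i => X ((ei m).symm i) - C (b ((ei m).symm i))

lemma tau_chart (F : MvPolynomial (Fin (m + 1)) K) (b : Fin m → K) :
    tau b (chartPoly F (Fin.last m) (sn b 1)) = dh F := by
  have : ((tau b).comp (aeval (fun i : Fin (m + 1) => if h : i = Fin.last m then
      (1 : MvPolynomial {i : Fin (m + 1) // i ≠ Fin.last m} K) else X ⟨i, h⟩ + C (sn b 1 i)))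
      : MvPolynomial (Fin (m + 1)) K →ₐ[K] MvPolynomial (Fin m) K) = aeval (sn X 1) := by
    apply MvPolynomial.algHom_ext
    intro i
    refine Fin.lastCases ?_ (fun k => ?_) i
    · simp [sn_last]
    · have hk : k.castSucc ≠ Fin.last m := (Fin.castSucc_lt_last k).ne
      rw [AlgHom.comp_apply, aeval_X, dif_neg hk, map_add, tau, aeval_X, aeval_X, sn_cast, sn_cast,
        algHom_C]
      have : (ei m).symm ⟨k.castSucc, hk⟩ = k := (ei m).symm_apply_apply k
      rw [this]
      simp
  exact congrArg (fun f => f F) this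

lemma tau_pderiv (b : Fin m → K) (k : Fin m)
    (q : MvPolynomial {i : Fin (m + 1) // i ≠ Fin.last m} K) :
    pderiv k (tau b q) = tau b (pderiv (ei m k) q) := by
  induction q using MvPolynomial.induction_on with
  | C a => simp [algHom_C]
  | add p q hp hq => simp only [map_add, hp, hq]
  | mul_X p i hp =>
    simp only [map_mul, Derivation.leibniz, smul_eq_mul, hp, map_add]
    congr 2
    obtain ⟨j, rfl⟩ := (ei m).surjective i
    simp only [tau, aeval_X, Equiv.symm_apply_apply, map_sub, pderiv_X, pderiv_C, sub_zero]
    by_cases h : j = k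
    · subst h; simp
    · rw [Pi.single_eq_of_ne h, Pi.single_eq_of_ne (fun h2 => h ((ei m).injective h2)), map_zero]

lemma eval_tau (b : Fin m → K) (q : MvPolynomial {i : Fin (m + 1) // i ≠ Fin.last m} K) :
    eval b (tau b q) = eval 0 q := by
  induction q using MvPolynomial.induction_on with
  | C a => simp [algHom_C]
  | add p q hp hq => simp only [map_add, hp, hq]
  | mul_X p i hp => rw [map_mul, map_mul, hp, map_mul]; simp [tau]

theorem loc_chart [IsAlgClosed K] (F : MvPolynomial (Fin (m + 1)) K) (b : Fin m → K)
    (hF : eval (sn b 1) F = 0) (d : ℕ) (hd : (d : K) ≠ 0)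
    (hi : IsIsolatedCriticalAtZero (chartPoly F (Fin.last m) (sn b 1)))
    (hw : WeightedHomogSing (chartPoly F (Fin.last m) (sn b 1)) d) : LocE (dh F) b := by
  obtain ⟨s, c, hs, hc, h⟩ := loc_main _ d hd
    (by rw [← eval_tau b, tau_chart, eval_dh, hF]) hi hw
  refine ⟨tau b s, fun k => tau b (c (ei m k)), by rwa [eval_tau], fun k => by rw [eval_tau, hc], ?_⟩
  have h2 := congrArg (tau b) h
  rw [map_mul, tau_chart, map_sum] at h2
  rw [h2, ← (ei m).sum_comp]
  refine Finset.sum_congr rfl fun k _ => ?_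
  rw [map_mul, ← tau_pderiv, tau_chart]

end Fin
end Bez
end

open Bez

/-- Proposition 6.5: under Hypothesis (A) or (B), if the common zeros of the
`∂f^(δ)/∂x_i` in `ℙ^{n-1}` are exactly the (distinct) points `(a_1,1), …, (a_s,1)` of
the chart `x_n ≠ 0`, and `μ_i` is the Milnor number at `a_i` of
`h = f^(δ)(y_1,…,y_{n-1},1)`, then
`M_f = dim_K K[x]/(∂f/∂x_1,…,∂f/∂x_n)` is finite and equals
`(δ-1)^n - (δ-δ') ∑ μ_i`. -/
theorem statement19 {K : Type*} [Field K] [IsAlgClosed K] (p : ℕ) [CharP K p]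
    (hp : p.Prime) {n : ℕ} (hn : 2 ≤ n) (f : MvPolynomial (Fin n) K) (δ δ' : ℕ)
    (hsetup : Setup δ δ' f)
    (hAB : HypA p δ δ' f ∨ HypB p δ δ' f)
    (s : ℕ) (a : Fin s → (Fin (n - 1) → K)) (hainj : Function.Injective a)
    (hzeros : ∀ x : Fin n → K, x ≠ 0 →
      ((∀ i, eval x (pderiv i (homogeneousComponent δ f)) = 0) ↔
        ∃ (j : Fin s) (c : K), c ≠ 0 ∧ x = c • liftPt (a j))) :
    FiniteDimensional K
      (MvPolynomial (Fin n) K ⧸ Ideal.span (Set.range fun i => pderiv i f)) ∧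
    (Module.finrank K
        (MvPolynomial (Fin n) K ⧸ Ideal.span (Set.range fun i => pderiv i f)) : ℤ)
      = ((δ - 1 : ℕ) : ℤ) ^ n - ((δ - δ' : ℕ) : ℤ) *
          ∑ j : Fin s, (milnorAt (a j) (dehomAtLast (homogeneousComponent δ f)) : ℤ) := by
  obtain ⟨m, rfl⟩ : ∃ m, n = m + 1 := ⟨n - 1, by omega⟩
  obtain ⟨hdeg, -, h1, h2, h3, -⟩ := hsetup
  change Fin s → (Fin m → K) at a
  have hsn : ∀ j, sn (a j) (1 : K) ≠ 0 := fun j h => by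
    have := congrFun h (Fin.last m)
    rw [sn_last] at this
    exact one_ne_zero this
  have hz : ∀ x : Fin (m + 1) → K, x ≠ 0 →
      ((∀ i, eval x (pderiv i (homogeneousComponent δ f)) = 0) ↔
        ∃ (j : Fin s) (c : K), c ≠ 0 ∧ x = c • sn (a j) 1) := by
    intro x hx
    rw [hzeros x hx]
    simp only [liftPt_eq]
  have hcrit : ∀ j i, eval (sn (a j) 1) (pderiv i (homogeneousComponent δ f)) = 0 := fun j =>
    (hz _ (hsn j)).2 ⟨j, 1, one_ne_zero, (one_smul _ _).symm⟩
  have hδ' : (δ' : K) ≠ 0 := by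
    rw [Ne, CharP.cast_eq_zero_iff K p]
    rcases hAB with h | h
    · exact h.2.1
    · exact h.2.1
  have key : (∀ j, eval (sn (a j) 1) (homogeneousComponent δ' f) ≠ 0) ∧
      ((δ : K) = 0 ∨ ∀ j, LocE (dh (homogeneousComponent δ f)) (a j)) := by
    rcases hAB with ⟨hA1, -, hA3⟩ | ⟨hB1, -, -, -, hB5⟩
    · have hδ : (δ : K) ≠ 0 := by rwa [Ne, CharP.cast_eq_zero_iff K p]
      have hev : ∀ j, eval (sn (a j) 1) (homogeneousComponent δ f) = 0 := by
        intro j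
        have := congrArg (eval (sn (a j) 1))
          (homogeneousComponent_isHomogeneous δ f).sum_X_mul_pderiv
        simp only [map_sum, map_mul, hcrit, mul_zero, Finset.sum_const_zero, nsmul_eq_mul,
          map_natCast] at this
        exact (mul_eq_zero.1 this.symm).resolve_left hδ
      have := fun j => hA3 (sn (a j) 1) (Fin.last m) (sn_last _ _) (hev j) (hcrit j)
      refine ⟨fun j => (this j).2.2, Or.inr fun j => ?_⟩
      obtain ⟨hi, ⟨d, hd, hw⟩, -⟩ := this j
      exact loc_chart _ _ (hev j) d (by rwa [Ne, CharP.cast_eq_zero_iff K p]) hi hw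
    · exact ⟨fun j => hB5 _ (hsn j) (hcrit j), Or.inl ((CharP.cast_eq_zero_iff K p δ).2 hB1)⟩
  obtain ⟨hfin, hcount⟩ := assemble f δ δ' hdeg h1 h2 h3 hδ' s a hainj hz key.1 key.2
  refine ⟨hfin, ?_⟩
  have h4 := congrArg (fun x : ℕ => (x : ℤ)) hcount
  simp only [Nat.cast_add, Nat.cast_mul, Nat.cast_pow, Nat.cast_sum] at h4
  simp only [dehom_eq]
  exact eq_sub_of_add_eq h4



end
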